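/- arXiv:1606.02994 — 2 statements merged into one kernel-verified Lean document; each statement's English description precedes it below -/
import Mathlib

section
/- Consider a birth and death process with bounded rates η and ν, and let {P_t}, {P̃_t} be the time marginals of two such processes with the same generator and initial laws P₀, P̃₀ on ℕ. Let ρ≥1 and assume E[X₀^ρ+X̃₀^ρ]<∞ (i.e. both initial laws have finite ρ-moment). Then there exists a constant C_ρ∈[0,∞) such that for any t≥0, W_ρ^ρ(P_t,P̃_t) ≤ W_ρ^ρ(P₀,P̃₀) e^{−κρt} + C_ρ(Lip(η)+Lip(ν)) ∫₀ᵗ e^{κρ(r−t)} ( W₁(P_r,P̃_r) + 1_{{ρ>2}} W_{ρ−1}^{ρ−1}(P_r,P̃_r) ) dr. Moreover, one can take C₁=0 when ρ=1 and C_ρ=1 when ρ∈(1,2]. -/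
open MeasureTheory

/-- `π` is a coupling of `P` and `Q`. -/
def IsCoupling {E : Type*} [MeasurableSpace E] (π : Measure (E × E)) (P Q : Measure E) : Prop :=
  π.map Prod.fst = P ∧ π.map Prod.snd = Q

/-- `wassersteinPow ρ P Q = W_ρ^ρ(P, Q)`. -/
noncomputable def wassersteinPow {E : Type*} [MeasurableSpace E] [NormedAddCommGroup E]
    (ρ : ℝ) (P Q : Measure E) : ℝ :=
  sInf {c : ℝ | ∃ π : Measure (E × E), IsCoupling π P Q ∧ c = ∫ p, ‖p.1 - p.2‖ ^ ρ ∂π}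

/-- `p : ℝ → ℕ → ℝ` is the family of time marginals (probability mass functions on `ℕ`)
of a birth and death process with birth rate `η` and death rate `ν`, i.e. a solution of
the Kolmogorov forward equations. -/
def IsBDMarginal (η ν : ℕ → ℝ) (p : ℝ → ℕ → ℝ) : Prop :=
  (∀ t : ℝ, 0 ≤ t → (∀ x, 0 ≤ p t x) ∧ HasSum (p t) 1) ∧
  (∀ x : ℕ, ∀ t : ℝ, 0 ≤ t →
    HasDerivWithinAt (fun s => p s x)
      ((if x = 0 then 0 else η (x - 1) * p t (x - 1)) + ν (x + 1) * p t (x + 1)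
        - (η x + ν x) * p t x)
      (Set.Ici 0) t)

/-- The probability measure on `ℝ` associated with a probability mass function on `ℕ`. -/
noncomputable def pmfMeasure (p : ℕ → ℝ) : Measure ℝ :=
  Measure.sum fun n => ENNReal.ofReal (p n) • Measure.dirac (n : ℝ)

/-- The Wasserstein curvature `κ = inf_x (η(x)+ν(x+1)−η(x+1)−ν(x))`. -/
noncomputable def bdKappa (η ν : ℕ → ℝ) : ℝ :=
  ⨅ x : ℕ, (η x + ν (x + 1) - η (x + 1) - ν x)

/-- `Lip(f) = sup_x |f(x+1) − f(x)|`. -/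
noncomputable def bdLip (f : ℕ → ℝ) : ℝ :=
  ⨆ x : ℕ, |f (x + 1) - f x|

open scoped ENNReal

theorem rpow_sub_rpow_le_mul {r x y : ℝ} (hr : 1 ≤ r) (hx : 0 < x) (hy : 0 ≤ y) :
    x ^ r - y ^ r ≤ r * x ^ (r - 1) * (x - y) := by
  have h := one_add_mul_self_le_rpow_one_add (s := y / x - 1) (by
    have : 0 ≤ y / x := by positivity
    linarith) hr
  rw [add_sub_cancel, Real.div_rpow hy hx.le, le_div_iff₀ (by positivity)] at h
  have h2 : x ^ r = x ^ (r - 1) * x := by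
    rw [← Real.rpow_add_one hx.ne']; ring_nf
  have h3 : (1 + r * (y / x - 1)) * x ^ r = x ^ r + r * x ^ (r - 1) * (y - x) := by
    rw [h2]; field_simp
  linarith

theorem add_one_rpow_le_of_le_two {ρ n : ℝ} (h1 : 1 < ρ) (h2 : ρ ≤ 2) (hn : 1 ≤ n) :
    (n + 1) ^ ρ - n ^ ρ ≤ ρ * n ^ (ρ - 1) + 1 := by
  let f : ℝ → ℝ := fun t => n ^ ρ + ρ * t * n ^ (ρ - 1) + t ^ ρ - (n + t) ^ ρ
  have hd : ∀ t ∈ Set.Ioo (0:ℝ) 1, HasDerivAt f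
      (ρ * n ^ (ρ - 1) + ρ * t ^ (ρ - 1) - ρ * (n + t) ^ (ρ - 1)) t := by
    intro t ht
    have a1 : HasDerivAt (fun t : ℝ => ρ * t * n ^ (ρ - 1)) (ρ * n ^ (ρ - 1)) t := by
      simpa using ((hasDerivAt_id t).const_mul ρ).mul_const (n ^ (ρ - 1))
    have a2 := Real.hasDerivAt_rpow_const (x := t) (p := ρ) (Or.inr h1.le)
    have a3 : HasDerivAt (fun t : ℝ => (n + t) ^ ρ) (1 * ρ * (n + t) ^ (ρ - 1)) t :=
      ((hasDerivAt_id t).const_add n).rpow_const (Or.inr h1.le)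
    exact (((a1.const_add (n ^ ρ)).add a2).sub a3).congr_deriv (by ring)
  have hm : MonotoneOn f (Set.Icc 0 1) := by
    apply monotoneOn_of_deriv_nonneg (convex_Icc 0 1)
    · apply ContinuousOn.sub
      · apply ContinuousOn.add (by fun_prop)
        exact continuousOn_id.rpow_const (fun x _ => Or.inr (by linarith))
      · exact (by fun_prop : ContinuousOn (fun t => n + t) _).rpow_const
          (fun x _ => Or.inr (by linarith))
    · rw [interior_Icc]
      exact fun t ht => (hd t ht).differentiableAt.differentiableWithinAt
    · rw [interior_Icc]
      intro t ht
      rw [(hd t ht).deriv]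
      have := Real.rpow_add_le_add_rpow (p := ρ - 1) (by linarith : 0 ≤ n) ht.1.le
        (by linarith) (by linarith)
      nlinarith
  have := hm (by simp) (by simp) (zero_le_one)
  simp only [f, Real.zero_rpow (by linarith : ρ ≠ 0), Real.one_rpow] at this
  simp at this
  linarith

theorem rpow_sub_one_rpow_ge_of_le_two {ρ n : ℝ} (h1 : 1 < ρ) (h2 : ρ ≤ 2) (hn : 1 ≤ n) :
    ρ * n ^ (ρ - 1) - 1 ≤ n ^ ρ - (n - 1) ^ ρ := by
  let f : ℝ → ℝ := fun t => n ^ ρ - ρ * t * n ^ (ρ - 1) + t ^ ρ - (n - t) ^ ρ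
  have hd : ∀ t ∈ Set.Ioo (0:ℝ) 1, HasDerivAt f
      (- (ρ * n ^ (ρ - 1)) + ρ * t ^ (ρ - 1) + ρ * (n - t) ^ (ρ - 1)) t := by
    intro t ht
    have a1 : HasDerivAt (fun t : ℝ => ρ * t * n ^ (ρ - 1)) (ρ * n ^ (ρ - 1)) t := by
      simpa using ((hasDerivAt_id t).const_mul ρ).mul_const (n ^ (ρ - 1))
    have a2 := Real.hasDerivAt_rpow_const (x := t) (p := ρ) (Or.inr h1.le)
    have a3 : HasDerivAt (fun t : ℝ => (n - t) ^ ρ) (-1 * ρ * (n - t) ^ (ρ - 1)) t :=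
      ((hasDerivAt_id t).const_sub n).rpow_const (Or.inr h1.le)
    exact (((a1.const_sub (n ^ ρ)).add a2).sub a3).congr_deriv (by ring)
  have hm : MonotoneOn f (Set.Icc 0 1) := by
    apply monotoneOn_of_deriv_nonneg (convex_Icc 0 1)
    · apply ContinuousOn.sub
      · apply ContinuousOn.add (by fun_prop)
        exact continuousOn_id.rpow_const (fun x _ => Or.inr (by linarith))
      · exact (by fun_prop : ContinuousOn (fun t => n - t) _).rpow_const
          (fun x _ => Or.inr (by linarith))
    · rw [interior_Icc]
      exact fun t ht => (hd t ht).differentiableAt.differentiableWithinAt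
    · rw [interior_Icc]
      intro t ht
      rw [(hd t ht).deriv]
      have := Real.rpow_add_le_add_rpow (p := ρ - 1) (by linarith [ht.2] : 0 ≤ n - t) ht.1.le
        (by linarith) (by linarith)
      rw [sub_add_cancel] at this
      nlinarith
  have := hm (by simp) (by simp) (zero_le_one)
  simp only [f, Real.zero_rpow (by linarith : ρ ≠ 0), Real.one_rpow] at this
  simp at this
  linarith

/-- The constant `C_ρ` of the inductive Wasserstein inequality. -/
noncomputable def inductiveConst (ρ : ℝ) : ℝ :=
  if ρ = 1 then 0 else if ρ ≤ 2 then 1 else ρ * (ρ - 1) * 2 ^ (ρ - 2)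

theorem inductiveConst_nonneg {ρ : ℝ} (hρ : 1 ≤ ρ) : 0 ≤ inductiveConst ρ := by
  unfold inductiveConst
  split_ifs
  · rfl
  · exact zero_le_one
  · have : 0 ≤ ρ - 1 := by linarith
    positivity

/-- The second-order error of the increments of `n ^ ρ`. -/
noncomputable def incrementError (ρ n : ℝ) : ℝ :=
  inductiveConst ρ * (1 + if 2 < ρ then n ^ (ρ - 2) else 0)

theorem incrementError_nonneg {ρ n : ℝ} (hρ : 1 ≤ ρ) (hn : 0 ≤ n) : 0 ≤ incrementError ρ n := by
  unfold incrementError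
  have := inductiveConst_nonneg hρ
  split_ifs <;> positivity

theorem add_one_rpow_le {ρ n : ℝ} (hρ : 1 ≤ ρ) (hn : 1 ≤ n) :
    (n + 1) ^ ρ - n ^ ρ ≤ ρ * n ^ (ρ - 1) + incrementError ρ n := by
  unfold incrementError inductiveConst
  rcases hρ.eq_or_lt with rfl | h1
  · simp
  rw [if_neg h1.ne']
  rcases le_or_gt ρ 2 with h2 | h2
  · rw [if_pos h2, if_neg h2.not_gt]
    have := add_one_rpow_le_of_le_two h1 h2 hn
    linarith
  · rw [if_neg h2.not_ge, if_pos h2]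
    have a := rpow_sub_rpow_le_mul hρ (by linarith : 0 < n + 1) (by linarith : 0 ≤ n)
    have b := rpow_sub_rpow_le_mul (by linarith : 1 ≤ ρ - 1) (by linarith : 0 < n + 1)
      (by linarith : 0 ≤ n)
    have c : (n + 1) ^ (ρ - 2) ≤ 2 ^ (ρ - 2) * n ^ (ρ - 2) := by
      rw [← Real.mul_rpow (by norm_num) (by linarith)]
      exact Real.rpow_le_rpow (by linarith) (by linarith) (by linarith)
    have e : ρ - 1 - 1 = ρ - 2 := by ring
    rw [e] at b
    have d : (0:ℝ) ≤ 2 ^ (ρ - 2) := by positivity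
    have f : (ρ - 1) * (n + 1) ^ (ρ - 2) ≤ (ρ - 1) * (2 ^ (ρ - 2) * n ^ (ρ - 2)) :=
      mul_le_mul_of_nonneg_left c (by linarith)
    have g : (n + 1) ^ (ρ - 1) ≤ n ^ (ρ - 1) + (ρ - 1) * (2 ^ (ρ - 2) * n ^ (ρ - 2)) := by
      linarith
    have i := mul_le_mul_of_nonneg_left g (by linarith : 0 ≤ ρ)
    have j : 0 ≤ ρ * (ρ - 1) * 2 ^ (ρ - 2) := by
      have : 0 ≤ ρ - 1 := by linarith
      positivity
    nlinarith

theorem rpow_sub_one_rpow_ge {ρ n : ℝ} (hρ : 1 ≤ ρ) (hn : 1 ≤ n) :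
    ρ * n ^ (ρ - 1) - incrementError ρ n ≤ n ^ ρ - (n - 1) ^ ρ := by
  unfold incrementError inductiveConst
  rcases hρ.eq_or_lt with rfl | h1
  · simp
  rw [if_neg h1.ne']
  rcases le_or_gt ρ 2 with h2 | h2
  · rw [if_pos h2, if_neg h2.not_gt]
    have := rpow_sub_one_rpow_ge_of_le_two h1 h2 hn
    linarith
  · rw [if_neg h2.not_ge, if_pos h2]
    have b := rpow_sub_rpow_le_mul (by linarith : 1 ≤ ρ - 1) (by linarith : 0 < n)
      (by linarith : 0 ≤ n - 1)
    have a : ρ * (n - 1) ^ (ρ - 1) ≤ n ^ ρ - (n - 1) ^ ρ := by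
      rcases hn.eq_or_lt with rfl | hn'
      · simp [Real.zero_rpow (by linarith : ρ ≠ 0), Real.zero_rpow (by linarith : ρ - 1 ≠ 0)]
      · have := rpow_sub_rpow_le_mul hρ (by linarith : 0 < n - 1) (by linarith : 0 ≤ n)
        linarith
    have e : ρ - 1 - 1 = ρ - 2 := by ring
    rw [e] at b
    have g : n ^ (ρ - 1) ≤ (n - 1) ^ (ρ - 1) + (ρ - 1) * n ^ (ρ - 2) := by linarith
    have i := mul_le_mul_of_nonneg_left g (by linarith : 0 ≤ ρ)
    have k : (1:ℝ) ≤ 2 ^ (ρ - 2) := Real.one_le_rpow (by norm_num) (by linarith)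
    have j : 0 ≤ ρ * (ρ - 1) := mul_nonneg (by linarith) (by linarith)
    have l : 0 ≤ n ^ (ρ - 2) := by positivity
    have m : ρ * (ρ - 1) * 1 ≤ ρ * (ρ - 1) * 2 ^ (ρ - 2) := mul_le_mul_of_nonneg_left k j
    have m2 := mul_le_mul_of_nonneg_right m l
    nlinarith

theorem increment_le {ρ n δ : ℝ} (hρ : 1 ≤ ρ) (hn : 1 ≤ n) :
    max δ 0 * ((n + 1) ^ ρ - n ^ ρ) + max (-δ) 0 * ((n - 1) ^ ρ - n ^ ρ)
      ≤ ρ * n ^ (ρ - 1) * δ + incrementError ρ n * |δ| := by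
  rcases le_total 0 δ with h | h
  · rw [max_eq_left h, max_eq_right (by linarith), abs_of_nonneg h]
    nlinarith [add_one_rpow_le hρ hn]
  · rw [max_eq_right h, max_eq_left (by linarith), abs_of_nonpos h]
    nlinarith [rpow_sub_one_rpow_ge hρ hn]

theorem increment_add_increment_le {ρ n δ ε κ l₁ l₂ : ℝ} (hρ : 1 ≤ ρ) (hn : 1 ≤ n)
    (hκ : δ + ε ≤ -κ * n) (hδ : |δ| ≤ l₁ * n) (hε : |ε| ≤ l₂ * n) :
    (max δ 0 * ((n + 1) ^ ρ - n ^ ρ) + max (-δ) 0 * ((n - 1) ^ ρ - n ^ ρ))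
      + (max ε 0 * ((n + 1) ^ ρ - n ^ ρ) + max (-ε) 0 * ((n - 1) ^ ρ - n ^ ρ))
      ≤ -κ * ρ * n ^ ρ
        + inductiveConst ρ * (l₁ + l₂) * (n + if 2 < ρ then n ^ (ρ - 1) else 0) := by
  have a := increment_le (δ := δ) hρ hn
  have b := increment_le (δ := ε) hρ hn
  have hn0 : 0 < n := by linarith
  have c : n ^ (ρ - 1) * n = n ^ ρ := by
    rw [← Real.rpow_add_one hn0.ne']; ring_nf
  have d : incrementError ρ n * n
      = inductiveConst ρ * (n + if 2 < ρ then n ^ (ρ - 1) else 0) := by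
    unfold incrementError
    have : n ^ (ρ - 2) * n = n ^ (ρ - 1) := by
      rw [← Real.rpow_add_one hn0.ne']; ring_nf
    split_ifs
    · rw [← this]; ring
    · ring
  have e := incrementError_nonneg hρ hn0.le
  have f : 0 ≤ ρ * n ^ (ρ - 1) := by positivity
  have g := mul_le_mul_of_nonneg_left hκ f
  have i := mul_le_mul_of_nonneg_left hδ e
  have j := mul_le_mul_of_nonneg_left hε e
  calc _ ≤ ρ * n ^ (ρ - 1) * (δ + ε) + (incrementError ρ n * |δ| + incrementError ρ n * |ε|) := by
        linarith
    _ ≤ ρ * n ^ (ρ - 1) * (-κ * n)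
        + (incrementError ρ n * (l₁ * n) + incrementError ρ n * (l₂ * n)) := by linarith
    _ = -κ * ρ * (n ^ (ρ - 1) * n) + (l₁ + l₂) * (incrementError ρ n * n) := by ring
    _ = _ := by rw [c, d]; ring

/-- The increments of `n ^ ρ`. -/
noncomputable def gapIncr (ρ : ℝ) (m : ℕ) : ℝ := ((m + 1 : ℕ) : ℝ) ^ ρ - (m : ℝ) ^ ρ

/-- The second differences of `|n| ^ ρ`. -/
noncomputable def gapWeight (ρ : ℝ) (d : ℕ) : ℝ :=
  if d = 0 then 1 else gapIncr ρ d - gapIncr ρ (d - 1)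

/-- The cost `(y - x)₊ ^ ρ`. -/
noncomputable def gapCost (ρ : ℝ) (x y : ℕ) : ℝ≥0∞ := ENNReal.ofReal (((y - x : ℕ) : ℝ) ^ ρ)

/-- The indicator of `x ≤ a` and `b < y`. -/
noncomputable def crossing (a b x y : ℕ) : ℝ≥0∞ := if x ≤ a ∧ b < y then 1 else 0

theorem gapIncr_nonneg {ρ : ℝ} (hρ : 1 ≤ ρ) (m : ℕ) : 0 ≤ gapIncr ρ m := by
  unfold gapIncr
  rw [sub_nonneg]
  exact Real.rpow_le_rpow (by positivity) (by push_cast; linarith) (by linarith)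

theorem gapWeight_nonneg {ρ : ℝ} (hρ : 1 ≤ ρ) (d : ℕ) : 0 ≤ gapWeight ρ d := by
  unfold gapWeight
  split_ifs with h
  · exact zero_le_one
  · obtain ⟨d, rfl⟩ := Nat.exists_eq_succ_of_ne_zero h
    have a := rpow_sub_rpow_le_mul hρ (by positivity : (0:ℝ) < (d:ℝ) + 1)
      (by positivity : (0:ℝ) ≤ (d:ℝ))
    have b := rpow_sub_rpow_le_mul hρ (by positivity : (0:ℝ) < (d:ℝ) + 1)
      (by positivity : (0:ℝ) ≤ (d:ℝ) + 1 + 1)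
    simp only [gapIncr, Nat.succ_eq_add_one, Nat.add_sub_cancel]
    push_cast
    linarith

theorem sum_gapWeight {ρ : ℝ} (hρ : 1 ≤ ρ) (m : ℕ) :
    ∑ d ∈ Finset.range (m + 1), gapWeight ρ d = gapIncr ρ m := by
  induction m with
  | zero => simp [gapWeight, gapIncr, Real.zero_rpow (by linarith : ρ ≠ 0)]
  | succ m ih =>
    rw [Finset.sum_range_succ, ih]
    simp [gapWeight]

theorem tsum_gapWeight_mul_crossing {ρ : ℝ} (hρ : 1 ≤ ρ) (a x y : ℕ) :
    ∑' d, ENNReal.ofReal (gapWeight ρ d) * crossing a (a + d) x y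
      = if x ≤ a ∧ a < y then ENNReal.ofReal (gapIncr ρ (y - x - 1 - (a - x))) else 0 := by
  split_ifs with h
  · rw [tsum_eq_sum (s := Finset.range (y - x - 1 - (a - x) + 1))]
    · rw [← sum_gapWeight hρ, ENNReal.ofReal_sum_of_nonneg (fun d _ => gapWeight_nonneg hρ d)]
      refine Finset.sum_congr rfl fun d hd => ?_
      rw [Finset.mem_range] at hd
      rw [crossing, if_pos ⟨h.1, by omega⟩, mul_one]
    · intro d hd
      rw [Finset.mem_range] at hd
      rw [crossing, if_neg (by omega), mul_zero]
  · rw [ENNReal.tsum_eq_zero]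
    intro d
    rw [crossing, if_neg (by omega), mul_zero]

theorem gapCost_eq_tsum {ρ : ℝ} (hρ : 1 ≤ ρ) (x y : ℕ) :
    gapCost ρ x y
      = ∑' i : ℕ × ℕ, ENNReal.ofReal (gapWeight ρ i.2) * crossing i.1 (i.1 + i.2) x y := by
  rw [ENNReal.tsum_prod']
  simp only [tsum_gapWeight_mul_crossing hρ]
  rw [tsum_eq_sum (s := Finset.Ico x y)]
  · have : ∀ a ∈ Finset.Ico x y,
        (if x ≤ a ∧ a < y then ENNReal.ofReal (gapIncr ρ (y - x - 1 - (a - x))) else 0)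
          = ENNReal.ofReal (gapIncr ρ (y - x - 1 - (a - x))) := by
      intro a ha
      rw [if_pos (Finset.mem_Ico.1 ha)]
    rw [Finset.sum_congr rfl this,
      ← ENNReal.ofReal_sum_of_nonneg (fun d _ => gapIncr_nonneg hρ _),
      Finset.sum_Ico_eq_sum_range]
    simp only [Nat.add_sub_cancel_left]
    rw [Finset.sum_range_reflect (fun j => gapIncr ρ j) (y - x)]
    unfold gapIncr
    rw [Finset.sum_range_sub (fun n : ℕ => (n : ℝ) ^ ρ)]
    simp [gapCost, Real.zero_rpow (by linarith : ρ ≠ 0)]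
  · intro a ha
    rw [if_neg (by simpa using ha)]

/-- The coupling operator `𝓛 + 2B`, where `𝓛` is the generator of the coupling of two copies of
the birth and death process maximizing the rate of simultaneous jumps. -/
noncomputable def couplingOp (η ν : ℕ → ℝ) (B : ℝ) (f : ℕ → ℕ → ℝ≥0∞) (x y : ℕ) : ℝ≥0∞ :=
  (ENNReal.ofReal (min (η x) (η y)) * f (x + 1) (y + 1) + ENNReal.ofReal (η x - η y) * f (x + 1) y
    + ENNReal.ofReal (η y - η x) * f x (y + 1) + ENNReal.ofReal (B - max (η x) (η y)) * f x y)
  + (ENNReal.ofReal (min (ν x) (ν y)) * f (x - 1) (y - 1)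
    + ENNReal.ofReal (ν x - ν y) * f (x - 1) y
    + ENNReal.ofReal (ν y - ν x) * f x (y - 1) + ENNReal.ofReal (B - max (ν x) (ν y)) * f x y)

/-- The operator `L + 2B`. -/
noncomputable def shiftedOp (η ν : ℕ → ℝ) (B : ℝ) (f : ℕ → ℝ≥0∞) (x : ℕ) : ℝ≥0∞ :=
  (ENNReal.ofReal (η x) * f (x + 1) + ENNReal.ofReal (B - η x) * f x)
  + (ENNReal.ofReal (ν x) * f (x - 1) + ENNReal.ofReal (B - ν x) * f x)

theorem couplingOp_tsum {ι : Type*} (η ν : ℕ → ℝ) (B : ℝ) (c : ι → ℝ≥0∞)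
    (f : ι → ℕ → ℕ → ℝ≥0∞) (x y : ℕ) :
    couplingOp η ν B (fun x y => ∑' i, c i * f i x y) x y
      = ∑' i, c i * couplingOp η ν B (f i) x y := by
  simp only [couplingOp, ← ENNReal.tsum_mul_left, ← ENNReal.tsum_add]
  refine tsum_congr fun i => ?_
  ring

theorem couplingOp_add (η ν : ℕ → ℝ) (B : ℝ) (f g : ℕ → ℕ → ℝ≥0∞) (x y : ℕ) :
    couplingOp η ν B (fun x y => f x y + g x y) x y
      = couplingOp η ν B f x y + couplingOp η ν B g x y := by
  simp only [couplingOp]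
  ring

theorem couplingOp_mono (η ν : ℕ → ℝ) (B : ℝ) {f g : ℕ → ℕ → ℝ≥0∞} (h : ∀ x y, f x y ≤ g x y)
    (x y : ℕ) : couplingOp η ν B f x y ≤ couplingOp η ν B g x y := by
  unfold couplingOp
  gcongr <;> exact h _ _

theorem ofReal_min_add_ofReal_sub {a b : ℝ} (hb : 0 ≤ b) :
    ENNReal.ofReal (min a b) + ENNReal.ofReal (a - b) = ENNReal.ofReal a := by
  rcases le_total a b with h | h
  · rw [min_eq_left h, ENNReal.ofReal_of_nonpos (by linarith : a - b ≤ 0), add_zero]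
  · rw [min_eq_right h, ← ENNReal.ofReal_add hb (by linarith)]
    congr 1; ring

theorem ofReal_sub_max_add_ofReal_sub {a b B : ℝ} (hb : b ≤ B) :
    ENNReal.ofReal (B - max a b) + ENNReal.ofReal (b - a) = ENNReal.ofReal (B - a) := by
  rcases le_total a b with h | h
  · rw [max_eq_right h, ← ENNReal.ofReal_add (by linarith) (by linarith)]
    congr 1; ring
  · rw [max_eq_left h, ENNReal.ofReal_of_nonpos (by linarith : b - a ≤ 0), add_zero]

section Rates

variable {η ν : ℕ → ℝ} {B : ℝ}

theorem couplingOp_fst (hη0 : ∀ x, 0 ≤ η x) (hν0 : ∀ x, 0 ≤ ν x)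
    (hB : ∀ x, η x ≤ B ∧ ν x ≤ B) (f : ℕ → ℝ≥0∞) (x y : ℕ) :
    couplingOp η ν B (fun x _ => f x) x y = shiftedOp η ν B f x := by
  unfold couplingOp shiftedOp
  rw [← ofReal_min_add_ofReal_sub (a := η x) (hη0 y),
    ← ofReal_min_add_ofReal_sub (a := ν x) (hν0 y),
    ← ofReal_sub_max_add_ofReal_sub (a := η x) (hB y).1,
    ← ofReal_sub_max_add_ofReal_sub (a := ν x) (hB y).2]
  ring

theorem couplingOp_snd (hη0 : ∀ x, 0 ≤ η x) (hν0 : ∀ x, 0 ≤ ν x)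
    (hB : ∀ x, η x ≤ B ∧ ν x ≤ B) (f : ℕ → ℝ≥0∞) (x y : ℕ) :
    couplingOp η ν B (fun _ y => f y) x y = shiftedOp η ν B f y := by
  unfold couplingOp shiftedOp
  rw [← ofReal_min_add_ofReal_sub (a := η y) (hη0 x),
    ← ofReal_min_add_ofReal_sub (a := ν y) (hν0 x),
    ← ofReal_sub_max_add_ofReal_sub (a := η y) (hB x).1,
    ← ofReal_sub_max_add_ofReal_sub (a := ν y) (hB x).2, min_comm (η x), min_comm (ν x),
    max_comm (η x), max_comm (ν x)]
  ring

/-- Monotonicity of the coupling operator compares the evolutions of distribution functions. -/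
theorem shiftedOp_le_add_couplingOp_crossing (hη0 : ∀ x, 0 ≤ η x) (hν0 : ∀ x, 0 ≤ ν x)
    (hB : ∀ x, η x ≤ B ∧ ν x ≤ B) (a b x y : ℕ) :
    shiftedOp η ν B (fun x => if x ≤ a then 1 else 0) x
      ≤ shiftedOp η ν B (fun y => if y ≤ b then 1 else 0) y
        + couplingOp η ν B (crossing a b) x y := by
  rw [← couplingOp_fst hη0 hν0 hB _ x y, ← couplingOp_snd hη0 hν0 hB _ x y, ← couplingOp_add]
  apply couplingOp_mono
  intro x y
  unfold crossing
  split_ifs <;> first | omega | simp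

theorem shiftedOp_indicator_add (hη0 : ∀ x, 0 ≤ η x) (hν0 : ∀ x, 0 ≤ ν x)
    (hB : ∀ x, η x ≤ B ∧ ν x ≤ B) (a x : ℕ) :
    shiftedOp η ν B (fun x => if x ≤ a then 1 else 0) x
        + ENNReal.ofReal (η a) * (if x = a then 1 else 0)
      = ENNReal.ofReal (2 * B) * (if x ≤ a then 1 else 0)
        + ENNReal.ofReal (ν (a + 1)) * (if x = a + 1 then 1 else 0) := by
  have e1 : ENNReal.ofReal (η x) + ENNReal.ofReal (B - η x) = ENNReal.ofReal B := by
    rw [← ENNReal.ofReal_add (hη0 x) (by linarith [(hB x).1])]; congr 1; ring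
  have e2 : ENNReal.ofReal (ν x) + ENNReal.ofReal (B - ν x) = ENNReal.ofReal B := by
    rw [← ENNReal.ofReal_add (hν0 x) (by linarith [(hB x).2])]; congr 1; ring
  have hB0 : 0 ≤ B := (hη0 0).trans (hB 0).1
  have e3 : ENNReal.ofReal (2 * B) = ENNReal.ofReal B + ENNReal.ofReal B := by
    rw [← ENNReal.ofReal_add hB0 hB0]; congr 1; ring
  unfold shiftedOp
  rcases lt_trichotomy x a with h | rfl | h
  · simp [h.le, h.ne, Nat.succ_le_of_lt h, show x - 1 ≤ a by omega, show x ≠ a + 1 by omega,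
      e1, e2, e3]
  · simp only [show ¬ (x + 1 ≤ x) by omega, show x - 1 ≤ x by omega, le_refl, if_true, if_false,
      mul_one, mul_zero, zero_add, add_zero, show x ≠ x + 1 by omega, e2, e3]
    rw [← e1]; ring
  · rcases (Nat.succ_le_of_lt h).eq_or_lt with h' | h'
    · simp [← h']
    · simp [show ¬ (x + 1 ≤ a) by omega, show ¬ (x - 1 ≤ a) by omega, show ¬ (x ≤ a) by omega,
        show x ≠ a by omega, show x ≠ a + 1 by omega]

end Rates

theorem sub_le_mul_of_forall_succ {f : ℕ → ℝ} {c : ℝ} (h : ∀ x, f (x + 1) - f x ≤ c) (x n : ℕ) :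
    f (x + n) - f x ≤ c * n := by
  induction n with
  | zero => simp
  | succ n ih =>
    have := h (x + n)
    rw [← add_assoc]
    push_cast
    linarith

theorem abs_sub_le_mul_of_forall_succ {f : ℕ → ℝ} {c : ℝ} (h : ∀ x, |f (x + 1) - f x| ≤ c)
    (x n : ℕ) : |f (x + n) - f x| ≤ c * n := by
  rw [abs_le']
  refine ⟨sub_le_mul_of_forall_succ (fun x => (le_abs_self _).trans (h x)) x n, ?_⟩
  have := sub_le_mul_of_forall_succ (f := fun x => - f x)
    (fun x => by have := (neg_le_abs _).trans (h x); linarith) x n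
  linarith

theorem couplingOp_gapCost_eq_zero (η ν : ℕ → ℝ) (B : ℝ) {ρ : ℝ} (hρ : 1 ≤ ρ) {x y : ℕ}
    (h : y ≤ x) : couplingOp η ν B (gapCost ρ) x y = 0 := by
  have z : ∀ {u v : ℕ}, v ≤ u → gapCost ρ u v = 0 := by
    intro u v huv
    simp [gapCost, Nat.sub_eq_zero_of_le huv, Real.zero_rpow (by linarith : ρ ≠ 0)]
  unfold couplingOp
  rcases h.eq_or_lt with rfl | h
  · simp [z]
  · simp [z (by omega : y + 1 ≤ x + 1), z (by omega : y ≤ x + 1), z (by omega : y + 1 ≤ x),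
      z (by omega : y ≤ x), z (by omega : y - 1 ≤ x - 1), z (by omega : y ≤ x - 1),
      z (by omega : y - 1 ≤ x)]

theorem ofReal_mul_gapCost {ρ c : ℝ} {x y n : ℕ} (h : y - x = n) :
    ENNReal.ofReal c * gapCost ρ x y = ENNReal.ofReal (max c 0 * (n : ℝ) ^ ρ) := by
  rw [gapCost, h, ENNReal.ofReal_mul (le_max_right _ _)]
  simp [ENNReal.ofReal_max]

theorem couplingOp_gapCost_le {η ν : ℕ → ℝ} {B ρ κ l₁ l₂ : ℝ}
    (hη0 : ∀ x, 0 ≤ η x) (hν0 : ∀ x, 0 ≤ ν x) (hν : ν 0 = 0)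
    (hB : ∀ x, η x ≤ B ∧ ν x ≤ B) (hρ : 1 ≤ ρ) (hκB : κ * ρ ≤ 2 * B)
    (hκ : ∀ x, κ ≤ η x + ν (x + 1) - η (x + 1) - ν x)
    (h₁ : ∀ x, |η (x + 1) - η x| ≤ l₁) (h₂ : ∀ x, |ν (x + 1) - ν x| ≤ l₂) (x y : ℕ) :
    couplingOp η ν B (gapCost ρ) x y
      ≤ ENNReal.ofReal (2 * B - κ * ρ) * gapCost ρ x y
        + ENNReal.ofReal (inductiveConst ρ * (l₁ + l₂))
          * (gapCost 1 x y + if 2 < ρ then gapCost (ρ - 1) x y else 0) := by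
  rcases le_or_gt y x with h | h
  · rw [couplingOp_gapCost_eq_zero η ν B hρ h]; exact zero_le
  obtain ⟨m, rfl⟩ := Nat.exists_eq_add_of_lt h
  set n : ℕ := m + 1 with hn
  have hxn : x + m + 1 = x + n := by omega
  rw [hxn]
  have hn1 : (1:ℝ) ≤ n := by rw [hn]; push_cast; linarith [Nat.cast_nonneg (α := ℝ) m]
  have hc : 0 ≤ inductiveConst ρ * (l₁ + l₂) :=
    mul_nonneg (inductiveConst_nonneg hρ)
      (add_nonneg ((abs_nonneg _).trans (h₁ 0)) ((abs_nonneg _).trans (h₂ 0)))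
  have main := increment_add_increment_le (δ := η (x + n) - η x) (ε := ν x - ν (x + n))
    (κ := κ) (l₁ := l₁) (l₂ := l₂) hρ hn1
    (by
      have := sub_le_mul_of_forall_succ (f := fun x => η x - ν x) (c := -κ)
        (fun x => by linarith [hκ x]) x n
      linarith)
    (abs_sub_le_mul_of_forall_succ h₁ x n)
    (by rw [abs_sub_comm]; exact abs_sub_le_mul_of_forall_succ h₂ x n)
  rw [neg_sub, neg_sub] at main
  have rhs : ENNReal.ofReal (2 * B - κ * ρ) * gapCost ρ x (x + n)
        + ENNReal.ofReal (inductiveConst ρ * (l₁ + l₂))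
          * (gapCost 1 x (x + n) + if 2 < ρ then gapCost (ρ - 1) x (x + n) else 0)
      = ENNReal.ofReal ((2 * B - κ * ρ) * (n : ℝ) ^ ρ + inductiveConst ρ * (l₁ + l₂)
          * (n + if 2 < ρ then (n : ℝ) ^ (ρ - 1) else 0)) := by
    have e : (gapCost 1 x (x + n) + if 2 < ρ then gapCost (ρ - 1) x (x + n) else 0)
        = ENNReal.ofReal (n + if 2 < ρ then (n : ℝ) ^ (ρ - 1) else 0) := by
      rw [ENNReal.ofReal_add (by positivity) (by split_ifs <;> positivity)]
      simp only [gapCost, Nat.add_sub_cancel_left, Real.rpow_one]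
      split_ifs <;> simp
    rw [e, gapCost, Nat.add_sub_cancel_left, ← ENNReal.ofReal_mul (by linarith),
      ← ENNReal.ofReal_mul hc, ENNReal.ofReal_add]
    · exact mul_nonneg (by linarith) (by positivity)
    · exact mul_nonneg hc (by split_ifs <;> positivity)
  have n1 : ((m : ℕ) : ℝ) = (n : ℝ) - 1 := by rw [hn]; push_cast; ring
  have lhs : couplingOp η ν B (gapCost ρ) x (x + n)
      = (ENNReal.ofReal (max (min (η x) (η (x + n))) 0 * (n : ℝ) ^ ρ)
        + ENNReal.ofReal (max (η x - η (x + n)) 0 * ((m : ℕ) : ℝ) ^ ρ)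
        + ENNReal.ofReal (max (η (x + n) - η x) 0 * ((n + 1 : ℕ) : ℝ) ^ ρ)
        + ENNReal.ofReal (max (B - max (η x) (η (x + n))) 0 * (n : ℝ) ^ ρ))
      + (ENNReal.ofReal (max (min (ν x) (ν (x + n))) 0 * (n : ℝ) ^ ρ)
        + ENNReal.ofReal (max (ν x - ν (x + n)) 0 * ((n + 1 : ℕ) : ℝ) ^ ρ)
        + ENNReal.ofReal (max (ν (x + n) - ν x) 0 * ((m : ℕ) : ℝ) ^ ρ)
        + ENNReal.ofReal (max (B - max (ν x) (ν (x + n))) 0 * (n : ℝ) ^ ρ)) := by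
    unfold couplingOp
    rw [ofReal_mul_gapCost (by omega : x + n + 1 - (x + 1) = n),
      ofReal_mul_gapCost (by omega : x + n - (x + 1) = m),
      ofReal_mul_gapCost (by omega : x + n + 1 - x = n + 1),
      ofReal_mul_gapCost (by omega : x + n - x = n),
      ofReal_mul_gapCost (by omega : x + n - 1 - x = m),
      ofReal_mul_gapCost (by omega : x + n - x = n)]
    rcases Nat.eq_zero_or_pos x with rfl | hx
    · have a1 : min (ν 0) (ν (0 + n)) = 0 := by rw [hν]; exact min_eq_left (hν0 _)
      have a2 : ν 0 - ν (0 + n) ≤ 0 := by rw [hν]; linarith [hν0 (0 + n)]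
      rw [a1, max_eq_right a2, ENNReal.ofReal_of_nonpos a2]
      simp
    · rw [ofReal_mul_gapCost (by omega : x + n - 1 - (x - 1) = n),
      ofReal_mul_gapCost (by omega : x + n - (x - 1) = n + 1)]
  rw [lhs, rhs]
  have pn : (0:ℝ) ≤ (n : ℝ) ^ ρ := by positivity
  rw [← ENNReal.ofReal_add (by positivity) (by positivity),
    ← ENNReal.ofReal_add (by positivity) (by positivity),
    ← ENNReal.ofReal_add (by positivity) (by positivity),
    ← ENNReal.ofReal_add (by positivity) (by positivity),
    ← ENNReal.ofReal_add (by positivity) (by positivity),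
    ← ENNReal.ofReal_add (by positivity) (by positivity),
    ← ENNReal.ofReal_add (by positivity) (by positivity)]
  apply ENNReal.ofReal_le_ofReal
  have total : ∀ a b : ℝ, 0 ≤ a → a ≤ B → 0 ≤ b → b ≤ B →
      max (min a b) 0 + max (B - max a b) 0 = B - max (a - b) 0 - max (b - a) 0 := by
    intro a b ha ha' hb hb'
    rw [max_eq_left (le_min ha hb), max_eq_left (sub_nonneg.2 (max_le ha' hb'))]
    rcases le_total a b with h | h
    · rw [min_eq_left h, max_eq_right h, max_eq_right (sub_nonpos.2 h),
        max_eq_left (sub_nonneg.2 h)]; ring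
    · rw [min_eq_right h, max_eq_left h, max_eq_left (sub_nonneg.2 h),
        max_eq_right (sub_nonpos.2 h)]; ring
  have t1 := total _ _ (hη0 x) (hB x).1 (hη0 (x + n)) (hB (x + n)).1
  have t2 := total _ _ (hν0 x) (hB x).2 (hν0 (x + n)) (hB (x + n)).2
  rw [n1]
  push_cast
  linear_combination main + (n : ℝ) ^ ρ * t1 + (n : ℝ) ^ ρ * t2

/-- `p` is a probability mass function on `ℕ`. -/
def IsProbMass (p : ℕ → ℝ) : Prop := (∀ x, 0 ≤ p x) ∧ HasSum p 1

/-- The distribution function of a mass function on `ℕ`. -/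
noncomputable def massCdf (p : ℕ → ℝ) (n : ℕ) : ℝ := ∑ x ∈ Finset.range (n + 1), p x

/-- The quantile function of a mass function on `ℕ`. -/
noncomputable def massQuantile (p : ℕ → ℝ) (u : ℝ) : ℕ := sInf {n | u ≤ massCdf p n}

/-- The uniform distribution on the unit interval. -/
noncomputable def unitMeasure : Measure ℝ := volume.restrict (Set.Ioc 0 1)

/-- The probability measure on `ℕ` associated with a mass function. -/
noncomputable def natLaw (p : ℕ → ℝ) : Measure ℕ :=
  Measure.sum fun n => ENNReal.ofReal (p n) • Measure.dirac n

instance : IsProbabilityMeasure unitMeasure := ⟨by simp [unitMeasure]⟩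

theorem massCdf_mono {p : ℕ → ℝ} (hp : ∀ x, 0 ≤ p x) : Monotone (massCdf p) := by
  intro m n h
  exact Finset.sum_le_sum_of_subset_of_nonneg (Finset.range_mono (by omega)) fun _ _ _ => hp _

theorem massCdf_nonneg {p : ℕ → ℝ} (hp : ∀ x, 0 ≤ p x) (n : ℕ) : 0 ≤ massCdf p n :=
  Finset.sum_nonneg fun _ _ => hp _

theorem massCdf_le_one {p : ℕ → ℝ} (hp : IsProbMass p) (n : ℕ) : massCdf p n ≤ 1 :=
  sum_le_hasSum _ (fun _ _ => hp.1 _) hp.2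

theorem exists_le_massCdf {p : ℕ → ℝ} (hp : IsProbMass p) {u : ℝ} (hu : u < 1) :
    ∃ n, u ≤ massCdf p n := by
  have h : Filter.Tendsto (fun n => massCdf p n) Filter.atTop (nhds 1) :=
    hp.2.tendsto_sum_nat.comp (Filter.tendsto_add_atTop_nat 1)
  obtain ⟨n, hn⟩ := (h.eventually_const_lt hu).exists
  exact ⟨n, hn.le⟩

theorem massQuantile_le_iff {p : ℕ → ℝ} (hp : IsProbMass p) {u : ℝ} (hu : u < 1) (n : ℕ) :
    massQuantile p u ≤ n ↔ u ≤ massCdf p n := by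
  refine ⟨fun h => ?_, fun h => Nat.sInf_le h⟩
  exact (Nat.sInf_mem (s := {n | u ≤ massCdf p n}) (exists_le_massCdf hp hu)).trans
    (massCdf_mono hp.1 h)

theorem measurable_massQuantile_prod {p : ℝ → ℕ → ℝ} (hp : ∀ r, IsProbMass (p r))
    (hm : ∀ x, Measurable fun r => p r x) :
    Measurable fun z : ℝ × ℝ => massQuantile (p z.1) z.2 := by
  have hF : ∀ n, Measurable fun z : ℝ × ℝ => massCdf (p z.1) n := by
    intro n
    unfold massCdf
    exact Finset.measurable_sum _ fun x _ => (hm x).comp measurable_fst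
  refine measurable_of_Iic fun n => ?_
  have : (fun z : ℝ × ℝ => massQuantile (p z.1) z.2) ⁻¹' Set.Iic n
      = {z | z.2 ≤ massCdf (p z.1) n} ∪ ⋂ k, {z | massCdf (p z.1) k < z.2} := by
    ext z
    simp only [Set.mem_preimage, Set.mem_Iic, Set.mem_union, Set.mem_ofPred_eq, Set.mem_iInter]
    constructor
    · intro h
      by_cases hne : ∃ k, z.2 ≤ massCdf (p z.1) k
      · exact Or.inl ((Nat.sInf_mem (s := {k | z.2 ≤ massCdf (p z.1) k}) hne).trans
          (massCdf_mono (hp _).1 h))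
      · exact Or.inr (by simpa using hne)
    · rintro (h | h)
      · exact Nat.sInf_le h
      · have : {k | z.2 ≤ massCdf (p z.1) k} = ∅ := by
          ext k; simpa using h k
        simp [massQuantile, this]
  rw [this]
  exact (measurableSet_le measurable_snd (hF n)).union
    (MeasurableSet.iInter fun k => measurableSet_lt (hF k) measurable_snd)

theorem measurable_massQuantile {p : ℕ → ℝ} (hp : IsProbMass p) : Measurable (massQuantile p) :=
  (measurable_massQuantile_prod (p := fun _ => p) (fun _ => hp)
    (fun _ => measurable_const)).comp (measurable_prodMk_left (x := (0 : ℝ)))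

theorem ae_unitMeasure_lt_one : ∀ᵐ u ∂unitMeasure, 0 < u ∧ u < 1 := by
  unfold unitMeasure
  rw [← restrict_Ioo_eq_restrict_Ioc]
  exact ae_restrict_mem measurableSet_Ioo

theorem unitMeasure_Ioc {a b : ℝ} (ha : 0 ≤ a) (hb : b ≤ 1) :
    unitMeasure (Set.Ioc a b) = ENNReal.ofReal (b - a) := by
  rw [unitMeasure, Measure.restrict_apply measurableSet_Ioc, Set.Ioc_inter_Ioc, max_eq_left ha,
    min_eq_left hb, Real.volume_Ioc]

theorem natLaw_apply (p : ℕ → ℝ) (s : Set ℕ) :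
    natLaw p s = ∑' n, ENNReal.ofReal (p n) * s.indicator 1 n := by
  rw [natLaw, Measure.sum_apply _ (MeasurableSet.of_discrete)]
  simp

theorem natLaw_Iic {p : ℕ → ℝ} (hp : ∀ x, 0 ≤ p x) (n : ℕ) :
    natLaw p (Set.Iic n) = ENNReal.ofReal (massCdf p n) := by
  rw [natLaw_apply, tsum_eq_sum (s := Finset.range (n + 1)), massCdf,
    ENNReal.ofReal_sum_of_nonneg (fun _ _ => hp _)]
  · refine Finset.sum_congr rfl fun x hx => ?_
    have : x ≤ n := by simpa [Nat.lt_succ_iff] using hx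
    simp [this]
  · intro x hx
    have : ¬ x ≤ n := by simpa [Nat.lt_succ_iff] using hx
    simp [this]

theorem natLaw_singleton (p : ℕ → ℝ) (n : ℕ) : natLaw p {n} = ENNReal.ofReal (p n) := by
  rw [natLaw_apply, tsum_eq_single n]
  · simp
  · intro m hm; simp [hm]

theorem map_massQuantile {p : ℕ → ℝ} (hp : IsProbMass p) :
    unitMeasure.map (massQuantile p) = natLaw p := by
  have : IsFiniteMeasure (unitMeasure.map (massQuantile p)) := inferInstance
  refine Measure.ext_of_Iic _ _ fun n => ?_
  rw [natLaw_Iic hp.1, Measure.map_apply (measurable_massQuantile hp) measurableSet_Iic]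
  have : massQuantile p ⁻¹' Set.Iic n =ᵐ[unitMeasure] Set.Ioc 0 (massCdf p n) := by
    filter_upwards [ae_unitMeasure_lt_one] with u hu
    apply propext
    change massQuantile p u ≤ n ↔ 0 < u ∧ u ≤ massCdf p n
    rw [massQuantile_le_iff hp hu.2]
    simp [hu.1]
  rw [measure_congr this, unitMeasure_Ioc le_rfl (massCdf_le_one hp n), sub_zero]

/-- The contribution of the event that the first coordinate is the smaller one to the optimal
transport cost for `|x - y| ^ ρ`. -/
noncomputable def gapSum (ρ : ℝ) (p q : ℕ → ℝ) : ℝ≥0∞ :=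
  ∑' i : ℕ × ℕ, ENNReal.ofReal (gapWeight ρ i.2)
    * ENNReal.ofReal (massCdf p i.1 - massCdf q (i.1 + i.2))

section Coupling

variable {Ω : Type*} [MeasurableSpace Ω] {m : Measure Ω} {X Y : Ω → ℕ} {p q : ℕ → ℝ}

theorem lintegral_crossing (hX : Measurable X) (hY : Measurable Y) (a b : ℕ) :
    ∫⁻ ω, crossing a b (X ω) (Y ω) ∂m = m {ω | X ω ≤ a ∧ b < Y ω} := by
  have hs : MeasurableSet {ω | X ω ≤ a ∧ b < Y ω} :=
    (measurableSet_le hX measurable_const).inter (measurableSet_lt measurable_const hY)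
  rw [← lintegral_indicator_one hs]
  refine lintegral_congr fun ω => ?_
  simp [crossing, Set.indicator_apply]

theorem measurable_of_nat_nat (hX : Measurable X) (hY : Measurable Y) {β : Type*}
    [MeasurableSpace β] (f : ℕ → ℕ → β) : Measurable fun ω => f (X ω) (Y ω) :=
  (measurable_from_top (f := fun z : ℕ × ℕ => f z.1 z.2)).comp
    (by
      have := hX.prodMk hY
      rwa [show (⊤ : MeasurableSpace (ℕ × ℕ)) = Prod.instMeasurableSpace from
        (MeasurableSpace.ext fun s => ⟨fun _ => MeasurableSet.of_discrete, fun _ => trivial⟩)])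

theorem lintegral_gapCost {ρ : ℝ} (hρ : 1 ≤ ρ) (hX : Measurable X) (hY : Measurable Y) :
    ∫⁻ ω, gapCost ρ (X ω) (Y ω) ∂m
      = ∑' i : ℕ × ℕ, ENNReal.ofReal (gapWeight ρ i.2)
          * m {ω | X ω ≤ i.1 ∧ i.1 + i.2 < Y ω} := by
  simp only [gapCost_eq_tsum hρ]
  rw [lintegral_tsum]
  · refine tsum_congr fun i => ?_
    rw [lintegral_const_mul _ (measurable_of_nat_nat hX hY _), lintegral_crossing hX hY]
  · exact fun i => ((measurable_of_nat_nat hX hY _).const_mul _).aemeasurable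

theorem ofReal_massCdf_sub_le (hX : Measurable X) (hY : Measurable Y)
    (hp : ∀ x, 0 ≤ p x) (hq : ∀ x, 0 ≤ q x)
    (hXp : m.map X = natLaw p) (hYq : m.map Y = natLaw q) (a b : ℕ) :
    ENNReal.ofReal (massCdf p a - massCdf q b) ≤ m {ω | X ω ≤ a ∧ b < Y ω} := by
  rw [ENNReal.ofReal_sub _ (massCdf_nonneg hq b), tsub_le_iff_right, ← natLaw_Iic hp,
    ← natLaw_Iic hq, ← hXp, ← hYq, Measure.map_apply hX measurableSet_Iic,
    Measure.map_apply hY measurableSet_Iic]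
  refine (measure_mono ?_).trans (measure_union_le _ _)
  intro ω hω
  rcases le_or_gt (Y ω) b with h | h
  · exact Or.inr h
  · exact Or.inl ⟨hω, h⟩

theorem gapSum_le_lintegral {ρ : ℝ} (hρ : 1 ≤ ρ) (hX : Measurable X) (hY : Measurable Y)
    (hp : ∀ x, 0 ≤ p x) (hq : ∀ x, 0 ≤ q x)
    (hXp : m.map X = natLaw p) (hYq : m.map Y = natLaw q) :
    gapSum ρ p q ≤ ∫⁻ ω, gapCost ρ (X ω) (Y ω) ∂m := by
  rw [lintegral_gapCost hρ hX hY]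
  refine ENNReal.tsum_le_tsum fun i => ?_
  gcongr
  exact ofReal_massCdf_sub_le hX hY hp hq hXp hYq _ _

end Coupling

theorem unitMeasure_crossing {p q : ℕ → ℝ} (hp : IsProbMass p) (hq : IsProbMass q) (a b : ℕ) :
    unitMeasure {u | massQuantile p u ≤ a ∧ b < massQuantile q u}
      = ENNReal.ofReal (massCdf p a - massCdf q b) := by
  rw [← unitMeasure_Ioc (massCdf_nonneg hq.1 b) (massCdf_le_one hp a)]
  apply measure_congr
  filter_upwards [ae_unitMeasure_lt_one] with u hu
  apply propext
  change massQuantile p u ≤ a ∧ b < massQuantile q u ↔ massCdf q b < u ∧ u ≤ massCdf p a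
  rw [massQuantile_le_iff hp hu.2, ← not_le, massQuantile_le_iff hq hu.2, not_le, and_comm]

theorem lintegral_gapCost_massQuantile {ρ : ℝ} (hρ : 1 ≤ ρ) {p q : ℕ → ℝ} (hp : IsProbMass p)
    (hq : IsProbMass q) :
    ∫⁻ u, gapCost ρ (massQuantile p u) (massQuantile q u) ∂unitMeasure = gapSum ρ p q := by
  rw [lintegral_gapCost hρ (measurable_massQuantile hp) (measurable_massQuantile hq), gapSum]
  exact tsum_congr fun i => by rw [unitMeasure_crossing hp hq]

/-- The moment of order `ρ` of a mass function on `ℕ`. -/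
noncomputable def powMoment (ρ : ℝ) (p : ℕ → ℝ) : ℝ≥0∞ := ∫⁻ n, gapCost ρ 0 n ∂natLaw p

theorem gapCost_le {ρ : ℝ} (hρ : 0 ≤ ρ) (x y : ℕ) : gapCost ρ x y ≤ gapCost ρ 0 y := by
  unfold gapCost
  gcongr
  omega

theorem gapSum_le_powMoment {ρ : ℝ} (hρ : 1 ≤ ρ) {p q : ℕ → ℝ} (hp : IsProbMass p)
    (hq : IsProbMass q) : gapSum ρ p q ≤ powMoment ρ q := by
  rw [← lintegral_gapCost_massQuantile hρ hp hq, powMoment, ← map_massQuantile hq,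
    lintegral_map measurable_from_top (measurable_massQuantile hq)]
  exact lintegral_mono fun u => gapCost_le (by linarith) _ _

theorem pmfMeasure_eq_map (p : ℕ → ℝ) :
    pmfMeasure p = (natLaw p).map (Nat.cast : ℕ → ℝ) := by
  rw [pmfMeasure, natLaw, Measure.map_sum measurable_from_top.aemeasurable]
  simp [Measure.map_smul, Measure.map_dirac]

theorem map_floor_pmfMeasure (p : ℕ → ℝ) : (pmfMeasure p).map (fun x => ⌊x⌋₊) = natLaw p := by
  rw [pmfMeasure_eq_map, Measure.map_map Nat.measurable_floor measurable_from_top]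
  have : (fun x : ℝ => ⌊x⌋₊) ∘ (Nat.cast : ℕ → ℝ) = id := by ext n; simp
  rw [this, Measure.map_id]

theorem ae_pmfMeasure_eq_floor (p : ℕ → ℝ) : ∀ᵐ x ∂pmfMeasure p, x = (⌊x⌋₊ : ℝ) := by
  rw [pmfMeasure_eq_map, ae_map_iff measurable_from_top.aemeasurable]
  · simp
  · exact measurableSet_eq_fun measurable_id
      ((measurable_from_top (f := fun n : ℕ => (n : ℝ))).comp Nat.measurable_floor)

theorem ofReal_norm_sub_rpow {ρ : ℝ} (hρ : 0 < ρ) (x y : ℕ) :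
    ENNReal.ofReal (‖(x : ℝ) - y‖ ^ ρ) = gapCost ρ x y + gapCost ρ y x := by
  rcases le_total x y with h | h
  · obtain ⟨d, rfl⟩ := Nat.exists_eq_add_of_le h
    have : x - (x + d) = 0 := by omega
    simp [gapCost, Real.zero_rpow hρ.ne', this]
  · obtain ⟨d, rfl⟩ := Nat.exists_eq_add_of_le h
    have : y - (y + d) = 0 := by omega
    simp [gapCost, Real.zero_rpow hρ.ne', this]

theorem measurable_floor_fst : Measurable fun z : ℝ × ℝ => ⌊z.1⌋₊ :=
  Nat.measurable_floor.comp measurable_fst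

theorem measurable_floor_snd : Measurable fun z : ℝ × ℝ => ⌊z.2⌋₊ :=
  Nat.measurable_floor.comp measurable_snd

theorem lintegral_norm_sub_rpow {ρ : ℝ} (hρ : 1 ≤ ρ) {p q : ℕ → ℝ} {π : Measure (ℝ × ℝ)}
    (hπ : IsCoupling π (pmfMeasure p) (pmfMeasure q)) :
    ∫⁻ z, ENNReal.ofReal (‖z.1 - z.2‖ ^ ρ) ∂π
      = ∫⁻ z, gapCost ρ ⌊z.1⌋₊ ⌊z.2⌋₊ ∂π + ∫⁻ z, gapCost ρ ⌊z.2⌋₊ ⌊z.1⌋₊ ∂π := by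
  rw [← lintegral_add_left (measurable_of_nat_nat measurable_floor_fst
    measurable_floor_snd (gapCost ρ))]
  have h1 : ∀ᵐ z ∂π, z.1 = (⌊z.1⌋₊ : ℝ) :=
    ae_of_ae_map measurable_fst.aemeasurable (hπ.1 ▸ ae_pmfMeasure_eq_floor p)
  have h2 : ∀ᵐ z ∂π, z.2 = (⌊z.2⌋₊ : ℝ) :=
    ae_of_ae_map measurable_snd.aemeasurable (hπ.2 ▸ ae_pmfMeasure_eq_floor q)
  refine lintegral_congr_ae ?_
  filter_upwards [h1, h2] with z hz1 hz2
  rw [← ofReal_norm_sub_rpow (by linarith), ← hz1, ← hz2]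

theorem integral_norm_sub_rpow (ρ : ℝ) (π : Measure (ℝ × ℝ)) :
    ∫ z, ‖z.1 - z.2‖ ^ ρ ∂π = (∫⁻ z, ENNReal.ofReal (‖z.1 - z.2‖ ^ ρ) ∂π).toReal := by
  refine integral_eq_lintegral_of_nonneg_ae (ae_of_all _ fun z => by positivity) ?_
  exact ((measurable_fst.sub measurable_snd).norm.pow_const ρ).aestronglyMeasurable

theorem wassersteinPow_pmfMeasure {ρ : ℝ} (hρ : 1 ≤ ρ) {p q : ℕ → ℝ} (hp : IsProbMass p)
    (hq : IsProbMass q) (hpm : powMoment ρ p ≠ ∞) (hqm : powMoment ρ q ≠ ∞) :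
    wassersteinPow ρ (pmfMeasure p) (pmfMeasure q) = (gapSum ρ p q + gapSum ρ q p).toReal := by
  refine IsLeast.csInf_eq ⟨?_, ?_⟩
  · have hm1 : Measurable fun u => (massQuantile p u : ℝ) :=
      measurable_from_top.comp (measurable_massQuantile hp)
    have hm2 : Measurable fun u => (massQuantile q u : ℝ) :=
      measurable_from_top.comp (measurable_massQuantile hq)
    have hc : IsCoupling (unitMeasure.map fun u => ((massQuantile p u : ℝ), (massQuantile q u : ℝ)))
        (pmfMeasure p) (pmfMeasure q) := by
      constructor
      · rw [Measure.map_map measurable_fst (hm1.prodMk hm2), pmfMeasure_eq_map,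
          ← map_massQuantile hp, Measure.map_map measurable_from_top (measurable_massQuantile hp)]
        rfl
      · rw [Measure.map_map measurable_snd (hm1.prodMk hm2), pmfMeasure_eq_map,
          ← map_massQuantile hq, Measure.map_map measurable_from_top (measurable_massQuantile hq)]
        rfl
    refine ⟨_, hc, ?_⟩
    rw [integral_norm_sub_rpow, lintegral_norm_sub_rpow hρ hc,
      lintegral_map (measurable_of_nat_nat measurable_floor_fst
        measurable_floor_snd (gapCost ρ)) (hm1.prodMk hm2),
      lintegral_map (measurable_of_nat_nat measurable_floor_snd
        measurable_floor_fst (gapCost ρ)) (hm1.prodMk hm2),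
      ← lintegral_gapCost_massQuantile hρ hp hq, ← lintegral_gapCost_massQuantile hρ hq hp]
    simp
  · rintro c ⟨π, hπ, rfl⟩
    rw [integral_norm_sub_rpow, lintegral_norm_sub_rpow hρ hπ]
    have hXp : π.map (fun z => ⌊z.1⌋₊) = natLaw p := by
      rw [← map_floor_pmfMeasure, ← hπ.1, Measure.map_map Nat.measurable_floor measurable_fst]
      rfl
    have hYq : π.map (fun z => ⌊z.2⌋₊) = natLaw q := by
      rw [← map_floor_pmfMeasure, ← hπ.2, Measure.map_map Nat.measurable_floor measurable_snd]
      rfl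
    have hle : ∀ {X Y : ℝ × ℝ → ℕ} {r : ℕ → ℝ}, Measurable Y → π.map Y = natLaw r →
        ∫⁻ z, gapCost ρ (X z) (Y z) ∂π ≤ powMoment ρ r := by
      intro X Y r hY hYr
      rw [powMoment, ← hYr, lintegral_map measurable_from_top hY]
      exact lintegral_mono fun z => gapCost_le (by linarith) _ _
    refine ENNReal.toReal_mono ?_ (add_le_add
      (gapSum_le_lintegral hρ measurable_floor_fst measurable_floor_snd hp.1 hq.1 hXp hYq)
      (gapSum_le_lintegral hρ measurable_floor_snd
        measurable_floor_fst hq.1 hp.1 hYq hXp))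
    exact ENNReal.add_ne_top.2 ⟨ne_top_of_le_ne_top hqm (hle measurable_floor_snd hYq),
      ne_top_of_le_ne_top hpm (hle measurable_floor_fst hXp)⟩

/-- The tail `∑_{x ≥ i} p x` of a mass function on `ℕ`. -/
noncomputable def massTail (p : ℕ → ℝ) (i : ℕ) : ℝ := 1 - ∑ x ∈ Finset.range i, p x

theorem massTail_succ (p : ℕ → ℝ) (i : ℕ) : massTail p (i + 1) = 1 - massCdf p i := rfl

theorem massTail_zero (p : ℕ → ℝ) : massTail p 0 = 1 := by simp [massTail]

theorem massTail_nonneg {p : ℕ → ℝ} (hp : IsProbMass p) (i : ℕ) : 0 ≤ massTail p i :=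
  sub_nonneg.2 (sum_le_hasSum _ (fun _ _ => hp.1 _) hp.2)

theorem le_massTail {p : ℕ → ℝ} (hp : IsProbMass p) (i : ℕ) : p i ≤ massTail p i := by
  have := massTail_nonneg hp (i + 1)
  rw [massTail, Finset.sum_range_succ] at this
  rw [massTail]
  linarith

theorem isProbabilityMeasure_natLaw {p : ℕ → ℝ} (hp : IsProbMass p) :
    IsProbabilityMeasure (natLaw p) := by
  rw [← map_massQuantile hp]
  exact Measure.isProbabilityMeasure_map (measurable_massQuantile hp).aemeasurable

theorem natLaw_Ici {p : ℕ → ℝ} (hp : IsProbMass p) (i : ℕ) :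
    natLaw p (Set.Ici i) = ENNReal.ofReal (massTail p i) := by
  have := isProbabilityMeasure_natLaw hp
  cases i with
  | zero =>
    rw [massTail_zero, show Set.Ici 0 = (Set.univ : Set ℕ) by ext; simp]
    simp
  | succ i =>
    have h : Set.Ici (i + 1) = (Set.Iic i)ᶜ := by ext n; simp
    rw [h, prob_compl_eq_one_sub measurableSet_Iic, natLaw_Iic hp.1, massTail_succ,
      ENNReal.ofReal_sub _ (massCdf_nonneg hp.1 i), ENNReal.ofReal_one]

theorem powMoment_eq_tsum_massTail {ρ : ℝ} (hρ : 1 ≤ ρ) {p : ℕ → ℝ} (hp : IsProbMass p) :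
    powMoment ρ p = ∑' i : ℕ × ℕ, ENNReal.ofReal (gapWeight ρ i.2)
      * ENNReal.ofReal (massTail p (i.1 + i.2 + 1)) := by
  rw [powMoment, lintegral_gapCost (X := fun _ => 0) (Y := fun n => n) hρ measurable_const
    measurable_id]
  refine tsum_congr fun i => ?_
  rw [← natLaw_Ici hp]
  congr 2
  ext n
  simp

/-- A flow of mass functions on `ℕ`, indexed by real times, that solves the forward equations of a
birth and death process at nonnegative times. -/
structure IsBDFlow (η ν : ℕ → ℝ) (p : ℝ → ℕ → ℝ) : Prop where
  isProbMass : ∀ r, IsProbMass (p r)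
  continuous : ∀ x, Continuous fun r => p r x
  hasDeriv : ∀ x t, 0 ≤ t → HasDerivWithinAt (fun s => p s x)
      ((if x = 0 then 0 else η (x - 1) * p t (x - 1)) + ν (x + 1) * p t (x + 1)
        - (η x + ν x) * p t x) (Set.Ici 0) t

theorem IsBDMarginal.isBDFlow {η ν : ℕ → ℝ} {p : ℝ → ℕ → ℝ} (hp : IsBDMarginal η ν p) :
    IsBDFlow η ν fun r => p (max r 0) where
  isProbMass r := hp.1 _ (le_max_right _ _)
  continuous x := by
    have h : ContinuousOn (fun r => p r x) (Set.Ici 0) := fun t ht =>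
      (hp.2 x t ht).continuousWithinAt
    exact h.comp_continuous (continuous_id.max continuous_const) fun r =>
      Set.mem_Ici.2 (le_max_right _ _)
  hasDeriv x t ht := by
    have h := hp.2 x t ht
    rw [max_eq_left ht]
    refine h.congr (fun s hs => ?_) ?_
    · rw [max_eq_left hs]
    · rw [max_eq_left ht]

/-- Upper bound for the tails of a pure birth process with rate `B` at time `t`. -/
noncomputable def tailBound (B : ℝ) (p : ℕ → ℝ) (t : ℝ) (i : ℕ) : ℝ :=
  ∑ j ∈ Finset.range (i + 1), (B * t) ^ j / j.factorial * massTail p (i - j)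

theorem tailBound_zero (B : ℝ) (p : ℕ → ℝ) (i : ℕ) : tailBound B p 0 i = massTail p i := by
  rw [tailBound, Finset.sum_eq_single 0]
  · simp
  · intro j _ hj
    simp [hj]
  · simp

theorem hasDerivAt_tailBound_succ (B : ℝ) (p : ℕ → ℝ) (t : ℝ) (i : ℕ) :
    HasDerivAt (fun s => tailBound B p s (i + 1)) (B * tailBound B p t i) t := by
  unfold tailBound
  have h : ∀ j : ℕ, HasDerivAt (fun s : ℝ => (B * s) ^ (j + 1) / (j + 1).factorial
      * massTail p (i + 1 - (j + 1)))
      (B * ((B * t) ^ j / j.factorial * massTail p (i - j))) t := by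
    intro j
    have h1 : HasDerivAt (fun s : ℝ => (B * s) ^ (j + 1))
        (((j + 1 : ℕ) : ℝ) * (B * t) ^ j * (B * 1)) t :=
      ((hasDerivAt_id t).const_mul B).pow (j + 1)
    refine ((h1.div_const _).mul_const _).congr_deriv ?_
    rw [Nat.factorial_succ, show i + 1 - (j + 1) = i - j by omega]
    push_cast
    have h2 : ((j : ℝ) + 1) ≠ 0 := by positivity
    have h3 : (j.factorial : ℝ) ≠ 0 := by positivity
    field_simp
  simp_rw [Finset.sum_range_succ' _ (i + 1)]
  rw [Finset.mul_sum]
  exact (HasDerivAt.fun_sum fun j (_ : j ∈ Finset.range (i + 1)) => h j).add_const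
    ((B * 0) ^ 0 / (Nat.factorial 0 : ℝ) * massTail p (i + 1 - 0))

theorem tailBound_mono {B : ℝ} (hB : 0 ≤ B) {p : ℕ → ℝ} (hp : IsProbMass p) {s t : ℝ} (hs : 0 ≤ s)
    (hst : s ≤ t) (i : ℕ) : tailBound B p s i ≤ tailBound B p t i := by
  refine Finset.sum_le_sum fun j _ => ?_
  have := massTail_nonneg hp (i - j)
  gcongr

section Flow

variable {η ν : ℕ → ℝ} {p : ℝ → ℕ → ℝ}

theorem IsBDFlow.hasDeriv_massCdf (hp : IsBDFlow η ν p) (hν : ν 0 = 0) (n : ℕ) {t : ℝ}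
    (ht : 0 ≤ t) :
    HasDerivWithinAt (fun s => massCdf (p s) n) (ν (n + 1) * p t (n + 1) - η n * p t n)
      (Set.Ici 0) t := by
  induction n with
  | zero =>
    have := hp.hasDeriv 0 t ht
    simpa [massCdf, hν] using this
  | succ n ih =>
    have h := ih.add (hp.hasDeriv (n + 1) t ht)
    refine (h.congr_deriv ?_).congr (fun s _ => ?_) ?_
    · simp
      ring
    · exact Finset.sum_range_succ _ _
    · exact Finset.sum_range_succ _ _

theorem IsBDFlow.continuous_massCdf (hp : IsBDFlow η ν p) (n : ℕ) :
    Continuous fun r => massCdf (p r) n :=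
  continuous_finsetSum _ fun x _ => hp.continuous x

theorem IsBDFlow.massTail_le_tailBound (hp : IsBDFlow η ν p) (hν0 : ∀ x, 0 ≤ ν x)
    (hν : ν 0 = 0) {B : ℝ} (hB0 : 0 ≤ B) (hB : ∀ x, η x ≤ B) (i : ℕ) {t : ℝ} (ht : 0 ≤ t) :
    massTail (p t) i ≤ tailBound B (p 0) t i := by
  induction i generalizing t with
  | zero => simp [tailBound, massTail_zero]
  | succ i ih =>
    have hd : ∀ s, 0 ≤ s → HasDerivWithinAt
        (fun r => tailBound B (p 0) r (i + 1) - massTail (p r) (i + 1))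
        (B * tailBound B (p 0) s i - -(ν (i + 1) * p s (i + 1) - η i * p s i)) (Set.Ici 0) s :=
      fun s hs => (hasDerivAt_tailBound_succ B (p 0) s i).hasDerivWithinAt.sub
        ((hp.hasDeriv_massCdf hν i hs).const_sub 1)
    have hmono : MonotoneOn (fun r => tailBound B (p 0) r (i + 1) - massTail (p r) (i + 1))
        (Set.Ici 0) := by
      refine monotoneOn_of_hasDerivWithinAt_nonneg (convex_Ici 0)
        (fun s hs => (hd s hs).continuousWithinAt)
        (fun s hs => (hd s (interior_subset hs)).mono interior_subset) fun s hs => ?_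
      have hs : 0 ≤ s := interior_subset hs
      have h1 := ih hs
      have h2 := le_massTail (hp.isProbMass s) i
      have h3 : 0 ≤ ν (i + 1) * p s (i + 1) := mul_nonneg (hν0 _) ((hp.isProbMass s).1 _)
      have h4 : η i * p s i ≤ B * p s i :=
        mul_le_mul_of_nonneg_right (hB i) ((hp.isProbMass s).1 _)
      have h5 : B * p s i ≤ B * tailBound B (p 0) s i :=
        mul_le_mul_of_nonneg_left (h2.trans h1) hB0
      linarith
    have := hmono Set.self_mem_Ici (Set.mem_Ici.2 ht) ht
    simp only [tailBound_zero, sub_self] at this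
    linarith

end Flow

/-- Dominates the tails of a birth and death process with birth rate at most `B` up to time `T`. -/
noncomputable def tailDom (B : ℝ) (p : ℕ → ℝ) (T : ℝ) (i : ℕ) : ℝ≥0∞ :=
  ∑' j : ℕ, ENNReal.ofReal ((B * T) ^ j / j.factorial) *
    ∑' n : ℕ, ENNReal.ofReal (p n) * crossing 0 i 0 (n + j)

theorem ofReal_tailBound_le {B T : ℝ} (hB : 0 ≤ B) (hT : 0 ≤ T) {p : ℕ → ℝ} (hp : IsProbMass p)
    (i : ℕ) : ENNReal.ofReal (tailBound B p T (i + 1)) ≤ tailDom B p T i := by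
  rw [tailBound, ENNReal.ofReal_sum_of_nonneg
    (fun j _ => mul_nonneg (by positivity) (massTail_nonneg hp _))]
  refine le_trans (Finset.sum_le_sum fun j _ => ?_) (ENNReal.sum_le_tsum (Finset.range (i + 1 + 1)))
  rw [ENNReal.ofReal_mul (by positivity), ← natLaw_Ici hp, natLaw_apply]
  gcongr with n
  by_cases h : i + 1 - j ≤ n
  · have : i < n + j := by omega
    simp [crossing, this, h]
  · simp [h]

theorem tsum_tailDom {ρ : ℝ} (hρ : 1 ≤ ρ) (B : ℝ) (p : ℕ → ℝ) (T : ℝ) :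
    ∑' i : ℕ × ℕ, ENNReal.ofReal (gapWeight ρ i.2) * tailDom B p T (i.1 + i.2)
      = ∑' j : ℕ, ENNReal.ofReal ((B * T) ^ j / j.factorial) *
          ∑' n : ℕ, ENNReal.ofReal (p n) * gapCost ρ 0 (n + j) := by
  simp only [tailDom, gapCost_eq_tsum hρ, ← ENNReal.tsum_mul_left]
  rw [ENNReal.tsum_comm]
  refine tsum_congr fun j => ?_
  rw [ENNReal.tsum_comm]
  refine tsum_congr fun n => tsum_congr fun i => ?_
  have : crossing 0 (i.1 + i.2) 0 (n + j) = crossing i.1 (i.1 + i.2) 0 (n + j) := by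
    simp [crossing]
  rw [this]
  ring

theorem summable_add_one_rpow_mul {ρ : ℝ} (hρ : 0 ≤ ρ) {p : ℕ → ℝ} (hp : IsProbMass p)
    (hm : Summable fun n : ℕ => (n : ℝ) ^ ρ * p n) :
    Summable fun n : ℕ => p n * ((n : ℝ) + 1) ^ ρ := by
  refine Summable.of_nonneg_of_le (fun n => mul_nonneg (hp.1 n) (by positivity)) (fun n => ?_)
    (hp.2.summable.add (hm.mul_left (2 ^ ρ)))
  rcases Nat.eq_zero_or_pos n with rfl | hn
  · have : 0 ≤ (2 : ℝ) ^ ρ * (((0 : ℕ) : ℝ) ^ ρ * p 0) :=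
      mul_nonneg (by positivity) (mul_nonneg (by positivity) (hp.1 0))
    simpa using this
  · have h1 : (1 : ℝ) ≤ n := by exact_mod_cast hn
    have h2 : ((n : ℝ) + 1) ^ ρ ≤ 2 ^ ρ * (n : ℝ) ^ ρ := by
      rw [← Real.mul_rpow (by norm_num) (by positivity)]
      exact Real.rpow_le_rpow (by positivity) (by linarith) hρ
    nlinarith [mul_le_mul_of_nonneg_right h2 (hp.1 n), hp.1 n]

theorem summable_pow_div_factorial_mul_rpow {ρ x : ℝ} (hρ : 0 ≤ ρ) (hx : 0 ≤ x) :
    Summable fun j : ℕ => x ^ j / j.factorial * ((j : ℝ) + 1) ^ ρ := by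
  refine Summable.of_nonneg_of_le (fun j => by positivity) (fun j => ?_)
    (Real.summable_pow_div_factorial (x * Real.exp ρ))
  have h : ((j : ℝ) + 1) ^ ρ ≤ Real.exp ρ ^ j := by
    calc ((j : ℝ) + 1) ^ ρ ≤ Real.exp j ^ ρ :=
          Real.rpow_le_rpow (by positivity) (Real.add_one_le_exp _) hρ
      _ = Real.exp ρ ^ j := by
          rw [← Real.exp_mul, ← Real.exp_nat_mul]
  calc x ^ j / j.factorial * ((j : ℝ) + 1) ^ ρ ≤ x ^ j / j.factorial * Real.exp ρ ^ j := by gcongr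
    _ = (x * Real.exp ρ) ^ j / j.factorial := by rw [mul_pow]; ring

theorem tsum_tailDom_ne_top {ρ : ℝ} (hρ : 1 ≤ ρ) {B T : ℝ} (hB : 0 ≤ B) (hT : 0 ≤ T) {p : ℕ → ℝ}
    (hp : IsProbMass p) (hm : Summable fun n : ℕ => (n : ℝ) ^ ρ * p n) :
    ∑' i : ℕ × ℕ, ENNReal.ofReal (gapWeight ρ i.2) * tailDom B p T (i.1 + i.2) ≠ ∞ := by
  have hρ0 : 0 ≤ ρ := by linarith
  have hc : ∀ j n : ℕ, gapCost ρ 0 (n + j)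
      ≤ ENNReal.ofReal (((j : ℝ) + 1) ^ ρ) * ENNReal.ofReal (((n : ℝ) + 1) ^ ρ) := by
    intro j n
    rw [← ENNReal.ofReal_mul (by positivity), ← Real.mul_rpow (by positivity) (by positivity),
      gapCost]
    refine ENNReal.ofReal_le_ofReal (Real.rpow_le_rpow (by positivity) ?_ hρ0)
    push_cast [Nat.sub_zero]
    nlinarith [mul_nonneg (Nat.cast_nonneg (α := ℝ) j) (Nat.cast_nonneg (α := ℝ) n)]
  have hle : ∑' j : ℕ, ENNReal.ofReal ((B * T) ^ j / j.factorial) *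
        ∑' n : ℕ, ENNReal.ofReal (p n) * gapCost ρ 0 (n + j)
      ≤ (∑' j : ℕ, ENNReal.ofReal ((B * T) ^ j / j.factorial * ((j : ℝ) + 1) ^ ρ)) *
        ∑' n : ℕ, ENNReal.ofReal (p n * ((n : ℝ) + 1) ^ ρ) := by
    rw [← ENNReal.tsum_mul_right]
    refine ENNReal.tsum_le_tsum fun j => ?_
    rw [ENNReal.ofReal_mul (by positivity), mul_assoc]
    gcongr
    rw [← ENNReal.tsum_mul_left]
    refine ENNReal.tsum_le_tsum fun n => ?_
    rw [ENNReal.ofReal_mul (hp.1 n)]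
    calc _ ≤ ENNReal.ofReal (p n) * (ENNReal.ofReal (((j : ℝ) + 1) ^ ρ)
            * ENNReal.ofReal (((n : ℝ) + 1) ^ ρ)) := by gcongr; exact hc j n
      _ = _ := by ring
  rw [tsum_tailDom hρ]
  refine ne_top_of_le_ne_top (ENNReal.mul_ne_top ?_ ?_) hle
  · exact (summable_pow_div_factorial_mul_rpow hρ0 (mul_nonneg hB hT)).tsum_ofReal_ne_top
  · exact (summable_add_one_rpow_mul hρ0 hp hm).tsum_ofReal_ne_top

section Moments

variable {η ν : ℕ → ℝ} {p q : ℝ → ℕ → ℝ} {ρ B : ℝ}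

theorem IsBDFlow.ofReal_massTail_le (hp : IsBDFlow η ν p) (hν0 : ∀ x, 0 ≤ ν x) (hν : ν 0 = 0)
    (hB0 : 0 ≤ B) (hB : ∀ x, η x ≤ B) {t T : ℝ} (ht : 0 ≤ t) (htT : t ≤ T) (i : ℕ) :
    ENNReal.ofReal (massTail (p t) (i + 1)) ≤ tailDom B (p 0) T i :=
  (ENNReal.ofReal_le_ofReal ((hp.massTail_le_tailBound hν0 hν hB0 hB _ ht).trans
    (tailBound_mono hB0 (hp.isProbMass 0) ht htT _))).trans
    (ofReal_tailBound_le hB0 (ht.trans htT) (hp.isProbMass 0) i)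

theorem IsBDFlow.powMoment_ne_top (hp : IsBDFlow η ν p) (hν0 : ∀ x, 0 ≤ ν x) (hν : ν 0 = 0)
    (hB0 : 0 ≤ B) (hB : ∀ x, η x ≤ B) (hρ : 1 ≤ ρ)
    (hm : Summable fun n : ℕ => (n : ℝ) ^ ρ * p 0 n) {t : ℝ} (ht : 0 ≤ t) :
    powMoment ρ (p t) ≠ ∞ := by
  rw [powMoment_eq_tsum_massTail hρ (hp.isProbMass t)]
  refine ne_top_of_le_ne_top (tsum_tailDom_ne_top hρ hB0 ht (hp.isProbMass 0) hm)
    (ENNReal.tsum_le_tsum fun i => ?_)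
  gcongr
  exact hp.ofReal_massTail_le hν0 hν hB0 hB ht le_rfl _

theorem IsBDFlow.gapSum_ne_top (hp : IsBDFlow η ν p) (hq : IsBDFlow η ν q) (hν0 : ∀ x, 0 ≤ ν x)
    (hν : ν 0 = 0) (hB0 : 0 ≤ B) (hB : ∀ x, η x ≤ B) (hρ : 1 ≤ ρ)
    (hm : Summable fun n : ℕ => (n : ℝ) ^ ρ * q 0 n) {t : ℝ} (ht : 0 ≤ t) :
    gapSum ρ (p t) (q t) ≠ ∞ :=
  ne_top_of_le_ne_top (hq.powMoment_ne_top hν0 hν hB0 hB hρ hm ht)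
    (gapSum_le_powMoment hρ (hp.isProbMass t) (hq.isProbMass t))

theorem gapSum_toReal (hρ : 1 ≤ ρ) (p q : ℕ → ℝ) :
    (gapSum ρ p q).toReal = ∑' i : ℕ × ℕ, gapWeight ρ i.2
      * max (massCdf p i.1 - massCdf q (i.1 + i.2)) 0 := by
  rw [gapSum, ENNReal.tsum_toReal_eq fun i => by finiteness]
  simp [ENNReal.toReal_ofReal', gapWeight_nonneg hρ]

theorem IsBDFlow.continuousOn_gapSum (hp : IsBDFlow η ν p) (hq : IsBDFlow η ν q)
    (hν0 : ∀ x, 0 ≤ ν x) (hν : ν 0 = 0) (hB0 : 0 ≤ B) (hB : ∀ x, η x ≤ B) (hρ : 1 ≤ ρ)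
    (hm : Summable fun n : ℕ => (n : ℝ) ^ ρ * q 0 n) {T : ℝ} (hT : 0 ≤ T) :
    ContinuousOn (fun t => (gapSum ρ (p t) (q t)).toReal) (Set.Icc 0 T) := by
  simp only [gapSum_toReal hρ]
  have hfin := tsum_tailDom_ne_top hρ hB0 hT (hq.isProbMass 0) hm
  refine continuousOn_tsum (fun i => ?_) (ENNReal.summable_toReal hfin) fun i t ht => ?_
  · have h1 := hp.continuous_massCdf i.1
    have h2 := hq.continuous_massCdf (i.1 + i.2)
    fun_prop
  · have hw := gapWeight_nonneg hρ i.2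
    rw [Real.norm_of_nonneg (by positivity),
      ← ENNReal.ofReal_le_iff_le_toReal (ENNReal.ne_top_of_tsum_ne_top hfin i),
      ENNReal.ofReal_mul hw]
    gcongr
    refine le_trans (ENNReal.ofReal_le_ofReal ?_)
      (hq.ofReal_massTail_le hν0 hν hB0 hB ht.1 ht.2 (i.1 + i.2))
    refine max_le ?_ (massTail_nonneg (hq.isProbMass t) _)
    rw [massTail_succ]
    linarith [massCdf_le_one (hp.isProbMass t) i.1]

end Moments

theorem ofReal_integral_le_lintegral_ofReal {α : Type*} [MeasurableSpace α] {μ : Measure α}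
    {f : α → ℝ} (hf : Integrable f μ) :
    ENNReal.ofReal (∫ x, f x ∂μ) ≤ ∫⁻ x, ENNReal.ofReal (f x) ∂μ := by
  rw [integral_eq_lintegral_pos_part_sub_lintegral_neg_part hf]
  exact (ENNReal.ofReal_le_ofReal (sub_le_self _ ENNReal.toReal_nonneg)).trans
    ENNReal.ofReal_toReal_le

section Rates

variable {η ν : ℕ → ℝ} {B : ℝ}

theorem lintegral_shiftedOp_add (hη0 : ∀ x, 0 ≤ η x) (hν0 : ∀ x, 0 ≤ ν x)
    (hB : ∀ x, η x ≤ B ∧ ν x ≤ B) {p : ℕ → ℝ} (hp : IsProbMass p) (a : ℕ) :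
    ∫⁻ u, shiftedOp η ν B (fun x => if x ≤ a then 1 else 0) (massQuantile p u) ∂unitMeasure
        + ENNReal.ofReal (η a * p a)
      = ENNReal.ofReal (2 * B * massCdf p a + ν (a + 1) * p (a + 1)) := by
  have hB0 : 0 ≤ B := (hη0 0).trans (hB 0).1
  have hle : ∫⁻ x, (if x ≤ a then 1 else 0) ∂natLaw p = ENNReal.ofReal (massCdf p a) := by
    rw [← natLaw_Iic hp.1, ← lintegral_indicator_one measurableSet_Iic]
    exact lintegral_congr fun x => by simp [Set.indicator_apply]
  have heq : ∀ b, ∫⁻ x, (if x = b then 1 else 0) ∂natLaw p = ENNReal.ofReal (p b) := by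
    intro b
    rw [← natLaw_singleton, ← lintegral_indicator_one (measurableSet_singleton b)]
    exact lintegral_congr fun x => by simp [Set.indicator_apply]
  rw [← lintegral_map (μ := unitMeasure) (g := massQuantile p) measurable_from_top
    (measurable_massQuantile hp), map_massQuantile hp,
    ENNReal.ofReal_mul (hη0 a), ← heq a, ← lintegral_const_mul _ measurable_from_top,
    ← lintegral_add_left measurable_from_top]
  simp only [shiftedOp_indicator_add hη0 hν0 hB]
  rw [lintegral_add_left measurable_from_top, lintegral_const_mul _ measurable_from_top,
    lintegral_const_mul _ measurable_from_top, hle, heq,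
    ENNReal.ofReal_add (mul_nonneg (by positivity) (massCdf_nonneg hp.1 a))
      (mul_nonneg (hν0 _) (hp.1 _)), ENNReal.ofReal_mul (p := 2 * B) (by positivity),
    ENNReal.ofReal_mul (hν0 _)]

theorem lintegral_shiftedOp (hη0 : ∀ x, 0 ≤ η x) (hν0 : ∀ x, 0 ≤ ν x)
    (hB : ∀ x, η x ≤ B ∧ ν x ≤ B) {p : ℕ → ℝ} (hp : IsProbMass p) (a : ℕ) :
    ∫⁻ u, shiftedOp η ν B (fun x => if x ≤ a then 1 else 0) (massQuantile p u) ∂unitMeasure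
      = ENNReal.ofReal (2 * B * massCdf p a + (ν (a + 1) * p (a + 1) - η a * p a)) := by
  rw [← add_sub_assoc, ENNReal.ofReal_sub _ (mul_nonneg (hη0 _) (hp.1 _)),
    ← lintegral_shiftedOp_add hη0 hν0 hB hp, ENNReal.add_sub_cancel_right ENNReal.ofReal_ne_top]

/-- The expected action of the coupling operator on `crossing a b` for the monotone coupling of
`p` and `q`. -/
noncomputable def crossingRate (η ν : ℕ → ℝ) (B : ℝ) (p q : ℕ → ℝ) (a b : ℕ) : ℝ≥0∞ :=
  ∫⁻ u, couplingOp η ν B (crossing a b) (massQuantile p u) (massQuantile q u) ∂unitMeasure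

theorem ofReal_sub_le_crossingRate (hη0 : ∀ x, 0 ≤ η x) (hν0 : ∀ x, 0 ≤ ν x)
    (hB : ∀ x, η x ≤ B ∧ ν x ≤ B) {p q : ℕ → ℝ} (hp : IsProbMass p) (hq : IsProbMass q) (a b : ℕ) :
    ENNReal.ofReal ((2 * B * massCdf p a + (ν (a + 1) * p (a + 1) - η a * p a))
        - (2 * B * massCdf q b + (ν (b + 1) * q (b + 1) - η b * q b)))
      ≤ crossingRate η ν B p q a b := by
  have hB0 : 0 ≤ B := (hη0 0).trans (hB 0).1
  have hq0 : 0 ≤ 2 * B * massCdf q b + (ν (b + 1) * q (b + 1) - η b * q b) := by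
    have h1 : q b ≤ massCdf q b :=
      Finset.single_le_sum (f := q) (fun _ _ => hq.1 _) (Finset.self_mem_range_succ b)
    have h2 : η b * q b ≤ B * massCdf q b := mul_le_mul (hB b).1 h1 (hq.1 b) hB0
    have h3 := mul_nonneg (hν0 (b + 1)) (hq.1 (b + 1))
    have h4 := mul_nonneg hB0 (massCdf_nonneg hq.1 b)
    linarith
  have hm : Measurable fun u =>
      shiftedOp η ν B (fun y => if y ≤ b then 1 else 0) (massQuantile q u) :=
    (measurable_from_top (f := shiftedOp η ν B fun y => if y ≤ b then 1 else 0)).comp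
      (measurable_massQuantile hq)
  rw [ENNReal.ofReal_sub _ hq0, ← lintegral_shiftedOp hη0 hν0 hB hp,
    ← lintegral_shiftedOp hη0 hν0 hB hq, tsub_le_iff_left, crossingRate,
    ← lintegral_add_left hm]
  exact lintegral_mono fun u => shiftedOp_le_add_couplingOp_crossing hη0 hν0 hB a b _ _

end Rates

section Flow

variable {η ν : ℕ → ℝ} {B : ℝ} {p q : ℝ → ℕ → ℝ}

theorem IsBDFlow.ofReal_exp_mul_massCdf_sub_le (hp : IsBDFlow η ν p) (hq : IsBDFlow η ν q)
    (hη0 : ∀ x, 0 ≤ η x) (hν0 : ∀ x, 0 ≤ ν x) (hν : ν 0 = 0) (hB : ∀ x, η x ≤ B ∧ ν x ≤ B)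
    {t : ℝ} (ht : 0 ≤ t) (a b : ℕ) :
    ENNReal.ofReal (Real.exp (2 * B * t)) * ENNReal.ofReal (massCdf (p t) a - massCdf (q t) b)
      ≤ ENNReal.ofReal (massCdf (p 0) a - massCdf (q 0) b)
        + ∫⁻ r in Set.Ioc 0 t, ENNReal.ofReal (Real.exp (2 * B * r))
            * crossingRate η ν B (p r) (q r) a b := by
  set h : ℝ → ℝ := fun r => Real.exp (2 * B * r) * (massCdf (p r) a - massCdf (q r) b) with h_def
  set h' : ℝ → ℝ := fun r => Real.exp (2 * B * r) *
    ((2 * B * massCdf (p r) a + (ν (a + 1) * p r (a + 1) - η a * p r a))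
        - (2 * B * massCdf (q r) b + (ν (b + 1) * q r (b + 1) - η b * q r b))) with h'_def
  have hFc := hp.continuous_massCdf a
  have hGc := hq.continuous_massCdf b
  have hc : Continuous h := by fun_prop
  have hc' : Continuous h' := by
    have h1 := hp.continuous a
    have h2 := hp.continuous (a + 1)
    have h3 := hq.continuous b
    have h4 := hq.continuous (b + 1)
    fun_prop
  have hd : ∀ r, 0 ≤ r → HasDerivWithinAt h (h' r) (Set.Ici 0) r := by
    intro r hr
    have h1 : HasDerivAt (fun r : ℝ => Real.exp (2 * B * r))
        (Real.exp (2 * B * r) * (2 * B * 1)) r :=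
      ((hasDerivAt_id r).const_mul (2 * B)).exp
    refine (h1.hasDerivWithinAt.mul
      ((hp.hasDeriv_massCdf hν a hr).sub (hq.hasDeriv_massCdf hν b hr))).congr_deriv ?_
    simp only [h'_def, Pi.sub_apply]
    ring
  have hint : ∫ r in (0 : ℝ)..t, h' r = h t - h 0 := by
    refine intervalIntegral.integral_eq_sub_of_hasDeriv_right_of_le ht hc.continuousOn
      (fun r hr => (hd r hr.1.le).mono ?_) (hc'.intervalIntegrable _ _)
    exact Set.Ioi_subset_Ici hr.1.le
  rw [← ENNReal.ofReal_mul (Real.exp_pos _).le]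
  have h0 : h 0 = massCdf (p 0) a - massCdf (q 0) b := by simp [h_def]
  have ht' : h t = h 0 + ∫ r in (0 : ℝ)..t, h' r := by rw [hint]; ring
  change ENNReal.ofReal (h t) ≤ _
  rw [ht', ← h0]
  refine ENNReal.ofReal_add_le.trans ?_
  gcongr
  rw [intervalIntegral.integral_of_le ht]
  refine (ofReal_integral_le_lintegral_ofReal (hc'.integrableOn_Ioc)).trans
    (lintegral_mono fun r => ?_)
  simp only [h'_def]
  rw [ENNReal.ofReal_mul (Real.exp_pos _).le]
  gcongr
  exact ofReal_sub_le_crossingRate hη0 hν0 hB (hp.isProbMass r) (hq.isProbMass r) a b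

theorem IsBDFlow.measurable_lintegral (hp : IsBDFlow η ν p) (hq : IsBDFlow η ν q)
    (f : ℕ → ℕ → ℝ≥0∞) :
    Measurable fun r => ∫⁻ u, f (massQuantile (p r) u) (massQuantile (q r) u) ∂unitMeasure :=
  Measurable.lintegral_prod_right' (f := fun z : ℝ × ℝ =>
      f (massQuantile (p z.1) z.2) (massQuantile (q z.1) z.2))
    (measurable_of_nat_nat
      (measurable_massQuantile_prod hp.isProbMass fun x => (hp.continuous x).measurable)
      (measurable_massQuantile_prod hq.isProbMass fun x => (hq.continuous x).measurable) f)

theorem lintegral_tsum_mul_comp {Ω ι : Type*} [MeasurableSpace Ω] [Countable ι] {m : Measure Ω}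
    {X Y : Ω → ℕ} (hX : Measurable X) (hY : Measurable Y) (c : ι → ℝ≥0∞) (f : ι → ℕ → ℕ → ℝ≥0∞) :
    ∫⁻ u, ∑' i, c i * f i (X u) (Y u) ∂m = ∑' i, c i * ∫⁻ u, f i (X u) (Y u) ∂m := by
  have hm : ∀ i, Measurable fun u => f i (X u) (Y u) := fun i => measurable_of_nat_nat hX hY (f i)
  rw [lintegral_tsum fun i => ((hm i).const_mul (c i)).aemeasurable]
  exact tsum_congr fun i => lintegral_const_mul _ (hm i)

theorem couplingOp_gapCost_eq_tsum {ρ : ℝ} (hρ : 1 ≤ ρ) (x y : ℕ) :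
    couplingOp η ν B (gapCost ρ) x y = ∑' i : ℕ × ℕ,
      ENNReal.ofReal (gapWeight ρ i.2) * couplingOp η ν B (crossing i.1 (i.1 + i.2)) x y := by
  rw [← couplingOp_tsum]
  congr 1
  ext x y
  exact gapCost_eq_tsum hρ x y

theorem tsum_gapWeight_mul_crossingRate {ρ : ℝ} (hρ : 1 ≤ ρ) {p q : ℕ → ℝ} (hp : IsProbMass p)
    (hq : IsProbMass q) :
    ∑' i : ℕ × ℕ, ENNReal.ofReal (gapWeight ρ i.2) * crossingRate η ν B p q i.1 (i.1 + i.2)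
      = ∫⁻ u, couplingOp η ν B (gapCost ρ) (massQuantile p u) (massQuantile q u) ∂unitMeasure := by
  simp only [couplingOp_gapCost_eq_tsum hρ, crossingRate]
  exact (lintegral_tsum_mul_comp (measurable_massQuantile hp) (measurable_massQuantile hq)
    (fun i : ℕ × ℕ => ENNReal.ofReal (gapWeight ρ i.2))
    fun i => couplingOp η ν B (crossing i.1 (i.1 + i.2))).symm

theorem IsBDFlow.exp_mul_gapSum_le (hp : IsBDFlow η ν p) (hq : IsBDFlow η ν q)
    (hη0 : ∀ x, 0 ≤ η x) (hν0 : ∀ x, 0 ≤ ν x) (hν : ν 0 = 0) (hB : ∀ x, η x ≤ B ∧ ν x ≤ B)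
    {ρ : ℝ} (hρ : 1 ≤ ρ) {t : ℝ} (ht : 0 ≤ t) :
    ENNReal.ofReal (Real.exp (2 * B * t)) * gapSum ρ (p t) (q t)
      ≤ gapSum ρ (p 0) (q 0) + ∫⁻ r in Set.Ioc 0 t, ENNReal.ofReal (Real.exp (2 * B * r))
          * ∫⁻ u, couplingOp η ν B (gapCost ρ) (massQuantile (p r) u) (massQuantile (q r) u)
              ∂unitMeasure := by
  have hexp : Measurable fun r : ℝ => ENNReal.ofReal (Real.exp (2 * B * r)) := by fun_prop
  have hK : ∀ a b, Measurable fun r => crossingRate η ν B (p r) (q r) a b := fun a b =>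
    hp.measurable_lintegral hq (couplingOp η ν B (crossing a b))
  have key : ∫⁻ r in Set.Ioc 0 t, ENNReal.ofReal (Real.exp (2 * B * r))
          * ∫⁻ u, couplingOp η ν B (gapCost ρ) (massQuantile (p r) u) (massQuantile (q r) u)
              ∂unitMeasure
      = ∑' i : ℕ × ℕ, ENNReal.ofReal (gapWeight ρ i.2) *
          ∫⁻ r in Set.Ioc 0 t, ENNReal.ofReal (Real.exp (2 * B * r))
            * crossingRate η ν B (p r) (q r) i.1 (i.1 + i.2) := by
    simp_rw [← tsum_gapWeight_mul_crossingRate hρ (hp.isProbMass _) (hq.isProbMass _),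
      ← ENNReal.tsum_mul_left]
    have hm : ∀ i : ℕ × ℕ, Measurable fun r => ENNReal.ofReal (Real.exp (2 * B * r)) *
        (ENNReal.ofReal (gapWeight ρ i.2) * crossingRate η ν B (p r) (q r) i.1 (i.1 + i.2)) :=
      fun i => hexp.mul ((hK _ _).const_mul _)
    rw [lintegral_tsum fun i => (hm i).aemeasurable]
    refine tsum_congr fun i => ?_
    have hm' : Measurable fun r => ENNReal.ofReal (Real.exp (2 * B * r)) *
        crossingRate η ν B (p r) (q r) i.1 (i.1 + i.2) := hexp.mul (hK _ _)
    rw [← lintegral_const_mul _ hm']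
    exact lintegral_congr fun r => by ring
  rw [key, gapSum, gapSum, ← ENNReal.tsum_mul_left, ← ENNReal.tsum_add]
  refine ENNReal.tsum_le_tsum fun i => ?_
  rw [mul_left_comm, ← mul_add]
  gcongr
  exact hp.ofReal_exp_mul_massCdf_sub_le hq hη0 hν0 hν hB ht _ _

theorem lintegral_couplingOp_gapCost_le {ρ κ l₁ l₂ : ℝ} (hη0 : ∀ x, 0 ≤ η x)
    (hν0 : ∀ x, 0 ≤ ν x) (hν : ν 0 = 0) (hB : ∀ x, η x ≤ B ∧ ν x ≤ B) (hρ : 1 ≤ ρ)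
    (hκB : κ * ρ ≤ 2 * B) (hκ : ∀ x, κ ≤ η x + ν (x + 1) - η (x + 1) - ν x)
    (h₁ : ∀ x, |η (x + 1) - η x| ≤ l₁) (h₂ : ∀ x, |ν (x + 1) - ν x| ≤ l₂) {p q : ℕ → ℝ}
    (hp : IsProbMass p) (hq : IsProbMass q) :
    ∫⁻ u, couplingOp η ν B (gapCost ρ) (massQuantile p u) (massQuantile q u) ∂unitMeasure
      ≤ ENNReal.ofReal (2 * B - κ * ρ) * gapSum ρ p q
        + ENNReal.ofReal (inductiveConst ρ * (l₁ + l₂))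
          * (gapSum 1 p q + if 2 < ρ then gapSum (ρ - 1) p q else 0) := by
  have hm : ∀ f : ℕ → ℕ → ℝ≥0∞, Measurable fun u => f (massQuantile p u) (massQuantile q u) :=
    fun f => measurable_of_nat_nat (measurable_massQuantile hp) (measurable_massQuantile hq) f
  refine (lintegral_mono fun u =>
    couplingOp_gapCost_le hη0 hν0 hν hB hρ hκB hκ h₁ h₂ _ _).trans_eq ?_
  rw [lintegral_add_left ((hm _).const_mul _), lintegral_const_mul _ (hm _),
    lintegral_gapCost_massQuantile hρ hp hq,
    lintegral_const_mul _ (hm fun x y => gapCost 1 x y + if 2 < ρ then gapCost (ρ - 1) x y else 0),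
    lintegral_add_left (hm _), lintegral_gapCost_massQuantile le_rfl hp hq]
  congr 3
  split_ifs with h
  · rw [lintegral_gapCost_massQuantile (by linarith) hp hq]
  · simp

end Flow

theorem le_exp_mul_add_integral_of_continuous {w g : ℝ → ℝ} {c l : ℝ} (hw : Continuous w)
    (hg : Continuous g) (hl : 0 ≤ l)
    (h : ∀ t, 0 ≤ t → Real.exp (c * t) * w t
      ≤ w 0 + ∫ r in (0 : ℝ)..t, Real.exp (c * r) * (l * w r + g r)) {T : ℝ} (hT : 0 ≤ T) :
    w T ≤ w 0 * Real.exp (-((c - l) * T))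
      + ∫ r in (0 : ℝ)..T, Real.exp ((c - l) * (r - T)) * g r := by
  set V : ℝ → ℝ := fun t => w 0 + ∫ r in (0 : ℝ)..t, Real.exp (c * r) * (l * w r + g r) with hV
  set G : ℝ → ℝ := fun t => ∫ r in (0 : ℝ)..t, Real.exp ((c - l) * r) * g r with hG
  have hVd : ∀ t, HasDerivAt V (Real.exp (c * t) * (l * w t + g t)) t := fun t =>
    ((by fun_prop :
      Continuous fun r => Real.exp (c * r) * (l * w r + g r)).integral_hasStrictDerivAt
      0 t).hasDerivAt.const_add _
  have hGd : ∀ t, HasDerivAt G (Real.exp ((c - l) * t) * g t) t := fun t =>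
    ((by fun_prop : Continuous fun r => Real.exp ((c - l) * r) * g r).integral_hasStrictDerivAt
      0 t).hasDerivAt
  have hEd : ∀ t, HasDerivAt (fun t : ℝ => Real.exp (-l * t)) (Real.exp (-l * t) * (-l * 1)) t :=
    fun t => ((hasDerivAt_id t).const_mul (-l)).exp
  have hd : ∀ t, HasDerivAt (fun t => Real.exp (-l * t) * V t - G t)
      (Real.exp (-l * t) * l * (Real.exp (c * t) * w t - V t)) t := by
    intro t
    refine (((hEd t).mul (hVd t)).sub (hGd t)).congr_deriv ?_
    rw [show (c - l) * t = -l * t + c * t by ring, Real.exp_add]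
    ring
  have hanti : AntitoneOn (fun t => Real.exp (-l * t) * V t - G t) (Set.Ici 0) := by
    refine antitoneOn_of_hasDerivWithinAt_nonpos (convex_Ici 0)
      (fun t _ => (hd t).continuousAt.continuousWithinAt)
      (fun t _ => (hd t).hasDerivWithinAt) fun t ht => ?_
    have ht : 0 ≤ t := interior_subset ht
    exact mul_nonpos_of_nonneg_of_nonpos (by positivity) (sub_nonpos.2 (h t ht))
  have h0 := hanti Set.self_mem_Ici (Set.mem_Ici.2 hT) hT
  simp only [hV, hG, intervalIntegral.integral_same, mul_zero, Real.exp_zero, add_zero, one_mul,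
    sub_zero] at h0
  change Real.exp (-l * T) * V T - G T ≤ w 0 at h0
  have hVT : Real.exp (c * T) * w T ≤ V T := h T hT
  have hI : ∫ r in (0 : ℝ)..T, Real.exp ((c - l) * (r - T)) * g r
      = Real.exp (-((c - l) * T)) * G T := by
    rw [hG, ← intervalIntegral.integral_const_mul]
    refine intervalIntegral.integral_congr fun r _ => ?_
    rw [← mul_assoc, ← Real.exp_add]
    congr 2
    ring
  rw [hI]
  calc w T = Real.exp (-(c * T)) * (Real.exp (c * T) * w T) := by
        rw [← mul_assoc, ← Real.exp_add]; simp
    _ ≤ Real.exp (-(c * T)) * V T := by gcongr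
    _ = Real.exp (-((c - l) * T)) * (Real.exp (-l * T) * V T) := by
        rw [← mul_assoc, ← Real.exp_add]; congr 2; ring
    _ ≤ Real.exp (-((c - l) * T)) * (w 0 + G T) := by
        gcongr
        linarith
    _ = _ := by ring

/-- A Grönwall inequality in integral form. -/
theorem le_exp_mul_add_integral {w g : ℝ → ℝ} {c l : ℝ} (hw : ContinuousOn w (Set.Ici 0))
    (hg : ContinuousOn g (Set.Ici 0)) (hl : 0 ≤ l)
    (h : ∀ t, 0 ≤ t → Real.exp (c * t) * w t
      ≤ w 0 + ∫ r in (0 : ℝ)..t, Real.exp (c * r) * (l * w r + g r)) {T : ℝ} (hT : 0 ≤ T) :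
    w T ≤ w 0 * Real.exp (-((c - l) * T))
      + ∫ r in (0 : ℝ)..T, Real.exp ((c - l) * (r - T)) * g r := by
  have hext : ∀ {f : ℝ → ℝ}, ContinuousOn f (Set.Ici 0) → Continuous fun r => f (max r 0) :=
    fun hf => hf.comp_continuous (continuous_id.max continuous_const) fun r =>
      Set.mem_Ici.2 (le_max_right _ _)
  have hpos : ∀ {t r : ℝ}, 0 ≤ t → r ∈ Set.uIcc 0 t → max r 0 = r := by
    intro t r ht hr
    rw [Set.uIcc_of_le ht] at hr
    exact max_eq_left hr.1
  have key := le_exp_mul_add_integral_of_continuous (c := c) (hext hw) (hext hg) hl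
    (fun t ht => ?_) hT
  · rw [max_eq_left hT, max_self] at key
    convert key using 2
    refine intervalIntegral.integral_congr fun r hr => ?_
    simp only [hpos hT hr]
  · rw [max_eq_left ht, max_self]
    convert h t ht using 2
    refine intervalIntegral.integral_congr fun r hr => ?_
    simp only [hpos ht hr]

/-- The optimal transport cost on `ℕ` for `|x - y| ^ ρ`. -/
noncomputable def transportCost (ρ : ℝ) (p q : ℕ → ℝ) : ℝ≥0∞ := gapSum ρ p q + gapSum ρ q p

theorem summable_rpow_mul_of_le {σ ρ : ℝ} (hσ : 0 < σ) (h : σ ≤ ρ) {p : ℕ → ℝ}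
    (hp : ∀ x, 0 ≤ p x) (hm : Summable fun n : ℕ => (n : ℝ) ^ ρ * p n) :
    Summable fun n : ℕ => (n : ℝ) ^ σ * p n := by
  refine Summable.of_nonneg_of_le (fun n => mul_nonneg (by positivity) (hp n)) (fun n => ?_) hm
  refine mul_le_mul_of_nonneg_right ?_ (hp n)
  rcases Nat.eq_zero_or_pos n with rfl | hn
  · simp [Real.zero_rpow hσ.ne', Real.zero_rpow (hσ.trans_le h).ne']
  · exact Real.rpow_le_rpow_of_exponent_le (by exact_mod_cast hn) h

section Flow

variable {η ν : ℕ → ℝ} {B : ℝ} {p q : ℝ → ℕ → ℝ} {ρ : ℝ}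

theorem IsBDFlow.transportCost_ne_top (hp : IsBDFlow η ν p) (hq : IsBDFlow η ν q)
    (hν0 : ∀ x, 0 ≤ ν x) (hν : ν 0 = 0) (hB0 : 0 ≤ B) (hB : ∀ x, η x ≤ B) (hρ : 1 ≤ ρ)
    (hm : Summable fun n : ℕ => (n : ℝ) ^ ρ * p 0 n)
    (hm' : Summable fun n : ℕ => (n : ℝ) ^ ρ * q 0 n) {t : ℝ} (ht : 0 ≤ t) :
    transportCost ρ (p t) (q t) ≠ ∞ :=
  ENNReal.add_ne_top.2 ⟨hp.gapSum_ne_top hq hν0 hν hB0 hB hρ hm' ht,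
    hq.gapSum_ne_top hp hν0 hν hB0 hB hρ hm ht⟩

theorem IsBDFlow.continuousOn_transportCost (hp : IsBDFlow η ν p) (hq : IsBDFlow η ν q)
    (hν0 : ∀ x, 0 ≤ ν x) (hν : ν 0 = 0) (hB0 : 0 ≤ B) (hB : ∀ x, η x ≤ B) (hρ : 1 ≤ ρ)
    (hm : Summable fun n : ℕ => (n : ℝ) ^ ρ * p 0 n)
    (hm' : Summable fun n : ℕ => (n : ℝ) ^ ρ * q 0 n) :
    ContinuousOn (fun t => (transportCost ρ (p t) (q t)).toReal) (Set.Ici 0) := by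
  intro t ht
  have ht : 0 ≤ t := ht
  have h : ContinuousOn (fun t => (transportCost ρ (p t) (q t)).toReal) (Set.Icc 0 (t + 1)) := by
    refine ((hp.continuousOn_gapSum hq hν0 hν hB0 hB hρ hm' (by linarith)).add
      (hq.continuousOn_gapSum hp hν0 hν hB0 hB hρ hm (by linarith))).congr fun r hr => ?_
    exact ENNReal.toReal_add (hp.gapSum_ne_top hq hν0 hν hB0 hB hρ hm' hr.1)
      (hq.gapSum_ne_top hp hν0 hν hB0 hB hρ hm hr.1)
  refine (h t ⟨ht, by linarith⟩).mono_of_mem_nhdsWithin ?_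
  rw [← Set.Ici_inter_Iic]
  exact Filter.inter_mem self_mem_nhdsWithin
    (mem_nhdsWithin_of_mem_nhds (Iic_mem_nhds (by linarith)))

theorem IsBDFlow.wassersteinPow_eq (hp : IsBDFlow η ν p) (hq : IsBDFlow η ν q)
    (hν0 : ∀ x, 0 ≤ ν x) (hν : ν 0 = 0) (hB0 : 0 ≤ B) (hB : ∀ x, η x ≤ B) (hρ : 1 ≤ ρ)
    (hm : Summable fun n : ℕ => (n : ℝ) ^ ρ * p 0 n)
    (hm' : Summable fun n : ℕ => (n : ℝ) ^ ρ * q 0 n) {t : ℝ} (ht : 0 ≤ t) :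
    wassersteinPow ρ (pmfMeasure (p t)) (pmfMeasure (q t))
      = (transportCost ρ (p t) (q t)).toReal :=
  wassersteinPow_pmfMeasure hρ (hp.isProbMass t) (hq.isProbMass t)
    (hp.powMoment_ne_top hν0 hν hB0 hB hρ hm ht) (hq.powMoment_ne_top hν0 hν hB0 hB hρ hm' ht)

theorem IsBDFlow.exp_mul_transportCost_le {κ l₁ l₂ : ℝ} (hp : IsBDFlow η ν p)
    (hq : IsBDFlow η ν q) (hη0 : ∀ x, 0 ≤ η x)
    (hν0 : ∀ x, 0 ≤ ν x) (hν : ν 0 = 0) (hB : ∀ x, η x ≤ B ∧ ν x ≤ B) (hρ : 1 ≤ ρ)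
    (hκB : κ * ρ ≤ 2 * B) (hκ : ∀ x, κ ≤ η x + ν (x + 1) - η (x + 1) - ν x)
    (h₁ : ∀ x, |η (x + 1) - η x| ≤ l₁) (h₂ : ∀ x, |ν (x + 1) - ν x| ≤ l₂) {t : ℝ} (ht : 0 ≤ t) :
    ENNReal.ofReal (Real.exp (2 * B * t)) * transportCost ρ (p t) (q t)
      ≤ transportCost ρ (p 0) (q 0) + ∫⁻ r in Set.Ioc 0 t, ENNReal.ofReal (Real.exp (2 * B * r))
          * (ENNReal.ofReal (2 * B - κ * ρ) * transportCost ρ (p r) (q r)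
            + ENNReal.ofReal (inductiveConst ρ * (l₁ + l₂)) * (transportCost 1 (p r) (q r)
              + if 2 < ρ then transportCost (ρ - 1) (p r) (q r) else 0)) := by
  have h1 := hp.exp_mul_gapSum_le hq hη0 hν0 hν hB hρ ht
  have h2 := hq.exp_mul_gapSum_le hp hη0 hν0 hν hB hρ ht
  rw [transportCost, mul_add]
  refine (add_le_add h1 h2).trans ?_
  rw [add_add_add_comm]
  refine add_le_add le_rfl ((le_lintegral_add _ _).trans (lintegral_mono fun r => ?_))
  rw [← mul_add]
  refine mul_le_mul' le_rfl ((add_le_add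
    (lintegral_couplingOp_gapCost_le hη0 hν0 hν hB hρ hκB hκ h₁ h₂ (hp.isProbMass r)
      (hq.isProbMass r))
    (lintegral_couplingOp_gapCost_le hη0 hν0 hν hB hρ hκB hκ h₁ h₂ (hq.isProbMass r)
      (hp.isProbMass r))).trans_eq ?_)
  simp only [transportCost]
  split_ifs <;> ring

theorem IsBDFlow.transportCost_le {κ l₁ l₂ : ℝ} (hp : IsBDFlow η ν p)
    (hq : IsBDFlow η ν q) (hη0 : ∀ x, 0 ≤ η x)
    (hν0 : ∀ x, 0 ≤ ν x) (hν : ν 0 = 0) (hB : ∀ x, η x ≤ B ∧ ν x ≤ B) (hρ : 1 ≤ ρ)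
    (hκB : κ * ρ ≤ 2 * B) (hκ : ∀ x, κ ≤ η x + ν (x + 1) - η (x + 1) - ν x)
    (h₁ : ∀ x, |η (x + 1) - η x| ≤ l₁) (h₂ : ∀ x, |ν (x + 1) - ν x| ≤ l₂)
    (hm : Summable fun n : ℕ => (n : ℝ) ^ ρ * p 0 n)
    (hm' : Summable fun n : ℕ => (n : ℝ) ^ ρ * q 0 n) {t : ℝ} (ht : 0 ≤ t) :
    (transportCost ρ (p t) (q t)).toReal
      ≤ (transportCost ρ (p 0) (q 0)).toReal * Real.exp (-(κ * ρ * t))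
        + ∫ r in (0 : ℝ)..t, Real.exp (κ * ρ * (r - t)) * (inductiveConst ρ * (l₁ + l₂)
          * ((transportCost 1 (p r) (q r)).toReal
            + if 2 < ρ then (transportCost (ρ - 1) (p r) (q r)).toReal else 0)) := by
  have hB0 : 0 ≤ B := (hη0 0).trans (hB 0).1
  have hηB : ∀ x, η x ≤ B := fun x => (hB x).1
  have hfin : ∀ σ, 1 ≤ σ → σ ≤ ρ → ∀ r, 0 ≤ r → transportCost σ (p r) (q r) ≠ ∞ :=
    fun σ h1 h2 r hr => hp.transportCost_ne_top hq hν0 hν hB0 hηB h1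
      (summable_rpow_mul_of_le (by linarith) h2 (hp.isProbMass 0).1 hm)
      (summable_rpow_mul_of_le (by linarith) h2 (hq.isProbMass 0).1 hm') hr
  have hcont : ∀ σ, 1 ≤ σ → σ ≤ ρ →
      ContinuousOn (fun r => (transportCost σ (p r) (q r)).toReal) (Set.Ici 0) :=
    fun σ h1 h2 => hp.continuousOn_transportCost hq hν0 hν hB0 hηB h1
      (summable_rpow_mul_of_le (by linarith) h2 (hp.isProbMass 0).1 hm)
      (summable_rpow_mul_of_le (by linarith) h2 (hq.isProbMass 0).1 hm')
  have hC : 0 ≤ inductiveConst ρ * (l₁ + l₂) := mul_nonneg (inductiveConst_nonneg hρ)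
    (add_nonneg ((abs_nonneg _).trans (h₁ 0)) ((abs_nonneg _).trans (h₂ 0)))
  have hl : 0 ≤ 2 * B - κ * ρ := by linarith
  set w : ℝ → ℝ := fun r => (transportCost ρ (p r) (q r)).toReal with hw
  set g : ℝ → ℝ := fun r => inductiveConst ρ * (l₁ + l₂)
          * ((transportCost 1 (p r) (q r)).toReal
            + if 2 < ρ then (transportCost (ρ - 1) (p r) (q r)).toReal else 0) with hg
  have hwc : ContinuousOn w (Set.Ici 0) := hcont ρ hρ le_rfl
  have hgc : ContinuousOn g (Set.Ici 0) := by
    refine continuousOn_const.mul ((hcont 1 le_rfl hρ).add ?_)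
    split_ifs with h
    · exact hcont (ρ - 1) (by linarith) (by linarith)
    · exact continuousOn_const
  have hw0 : ∀ r, 0 ≤ w r := fun r => ENNReal.toReal_nonneg
  have hg0 : ∀ r, 0 ≤ g r := fun r => by
    have : 0 ≤ if 2 < ρ then (transportCost (ρ - 1) (p r) (q r)).toReal else 0 := by
      split_ifs <;> simp
    positivity
  have hint : ∀ s, 0 ≤ s → Real.exp (2 * B * s) * w s
      ≤ w 0 + ∫ r in (0 : ℝ)..s, Real.exp (2 * B * r) * ((2 * B - κ * ρ) * w r + g r) := by
    intro s hs
    have hF0 : ∀ r, 0 ≤ Real.exp (2 * B * r) * ((2 * B - κ * ρ) * w r + g r) := fun r =>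
      mul_nonneg (Real.exp_pos _).le (add_nonneg (mul_nonneg hl (hw0 r)) (hg0 r))
    have hFc : ContinuousOn (fun r => Real.exp (2 * B * r) * ((2 * B - κ * ρ) * w r + g r))
        (Set.Icc 0 s) :=
      ContinuousOn.mono (by fun_prop) Set.Icc_subset_Ici_self
    have hFi : IntegrableOn (fun r => Real.exp (2 * B * r) * ((2 * B - κ * ρ) * w r + g r))
        (Set.Ioc 0 s) := hFc.integrableOn_Icc.mono_set Set.Ioc_subset_Icc_self
    rw [intervalIntegral.integral_of_le hs]
    have hI0 : 0 ≤ ∫ r in Set.Ioc 0 s, Real.exp (2 * B * r) * ((2 * B - κ * ρ) * w r + g r) :=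
      integral_nonneg hF0
    rw [← ENNReal.ofReal_le_ofReal_iff (add_nonneg (hw0 0) hI0),
      ENNReal.ofReal_mul (Real.exp_pos _).le, ENNReal.ofReal_add (hw0 0) hI0,
      ofReal_integral_eq_lintegral_ofReal hFi (ae_of_all _ hF0), hw,
      ENNReal.ofReal_toReal (hfin ρ hρ le_rfl s hs),
      ENNReal.ofReal_toReal (hfin ρ hρ le_rfl 0 le_rfl)]
    refine (hp.exp_mul_transportCost_le hq hη0 hν0 hν hB hρ hκB hκ h₁ h₂ hs).trans_eq ?_
    congr 1
    refine setLIntegral_congr_fun measurableSet_Ioc fun r hr => ?_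
    have hr0 : 0 ≤ r := hr.1.le
    simp only [hg]
    have e1 := ENNReal.ofReal_toReal (hfin ρ hρ le_rfl r hr0)
    have e2 := ENNReal.ofReal_toReal (hfin 1 le_rfl hρ r hr0)
    have e3 : ENNReal.ofReal (if 2 < ρ then (transportCost (ρ - 1) (p r) (q r)).toReal else 0)
        = if 2 < ρ then transportCost (ρ - 1) (p r) (q r) else 0 := by
      split_ifs with h
      · exact ENNReal.ofReal_toReal (hfin (ρ - 1) (by linarith) (by linarith) r hr0)
      · simp
    rw [ENNReal.ofReal_mul (Real.exp_pos _).le,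
      ENNReal.ofReal_add (mul_nonneg hl ENNReal.toReal_nonneg) (hg0 r), ENNReal.ofReal_mul hl,
      ENNReal.ofReal_mul hC, ENNReal.ofReal_add ENNReal.toReal_nonneg
        (by split_ifs <;> simp), e1, e2, e3]
  have := le_exp_mul_add_integral hwc hgc hl hint ht
  simpa only [sub_sub_cancel] using this

end Flow

theorem bddBelow_curvature {η ν : ℕ → ℝ} (hη0 : ∀ x, 0 ≤ η x) (hν0 : ∀ x, 0 ≤ ν x) {B : ℝ}
    (hB : ∀ x, η x ≤ B ∧ ν x ≤ B) :
    BddBelow (Set.range fun x : ℕ => η x + ν (x + 1) - η (x + 1) - ν x) := by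
  refine ⟨-(2 * B), ?_⟩
  rintro _ ⟨x, rfl⟩
  simp only
  linarith [hη0 x, hν0 (x + 1), (hB (x + 1)).1, (hB x).2]

theorem abs_sub_le_bdLip {f : ℕ → ℝ} {B : ℝ} (hf0 : ∀ x, 0 ≤ f x) (hf : ∀ x, f x ≤ B) (x : ℕ) :
    |f (x + 1) - f x| ≤ bdLip f := by
  refine le_ciSup (f := fun x : ℕ => |f (x + 1) - f x|) ⟨B, ?_⟩ x
  rintro _ ⟨y, rfl⟩
  exact abs_le.2 ⟨by linarith [hf0 (y + 1), hf y], by linarith [hf0 y, hf (y + 1)]⟩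

/-- for two birth and death processes with the same bounded rates `η, ν` and
finite initial `ρ`-moments, the inductive Wasserstein inequality holds with a constant
`C_ρ` which can be taken `0` for `ρ = 1` and `1` for `ρ ∈ (1,2]`. -/
theorem stmt8 (η ν : ℕ → ℝ) (hη0 : ∀ x, 0 ≤ η x) (hν0 : ∀ x, 0 ≤ ν x) (hν : ν 0 = 0)
    (B : ℝ) (hB : ∀ x, η x ≤ B ∧ ν x ≤ B)
    (p pt : ℝ → ℕ → ℝ) (hp : IsBDMarginal η ν p) (hpt : IsBDMarginal η ν pt)
    (ρ : ℝ) (hρ : 1 ≤ ρ)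
    (hm : Summable fun n : ℕ => (n : ℝ) ^ ρ * p 0 n)
    (hmt : Summable fun n : ℕ => (n : ℝ) ^ ρ * pt 0 n) :
    ∃ Cρ : ℝ, 0 ≤ Cρ ∧ (ρ = 1 → Cρ = 0) ∧ (1 < ρ → ρ ≤ 2 → Cρ = 1) ∧
      ∀ t : ℝ, 0 ≤ t →
        wassersteinPow ρ (pmfMeasure (p t)) (pmfMeasure (pt t))
          ≤ wassersteinPow ρ (pmfMeasure (p 0)) (pmfMeasure (pt 0))
              * Real.exp (-(bdKappa η ν) * ρ * t)
            + Cρ * (bdLip η + bdLip ν) *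
                ∫ r in (0:ℝ)..t, Real.exp (bdKappa η ν * ρ * (r - t)) *
                  (wassersteinPow 1 (pmfMeasure (p r)) (pmfMeasure (pt r))
                    + if 2 < ρ then
                        wassersteinPow (ρ - 1) (pmfMeasure (p r)) (pmfMeasure (pt r))
                      else 0) := by
  refine ⟨inductiveConst ρ, inductiveConst_nonneg hρ, fun h => by simp [inductiveConst, h],
    fun h1 h2 => by simp [inductiveConst, h1.ne', h2], fun t ht => ?_⟩
  set κ := bdKappa η ν with hκ_def
  have hκρ : 0 ≤ |κ| * ρ := by positivity
  have hB0 : 0 ≤ B := (hη0 0).trans (hB 0).1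
  have hηB : ∀ x, η x ≤ B := fun x => (hB x).1
  have hB' : ∀ x, η x ≤ B + |κ| * ρ ∧ ν x ≤ B + |κ| * ρ := fun x =>
    ⟨by linarith [(hB x).1], by linarith [(hB x).2]⟩
  have hκB : κ * ρ ≤ 2 * (B + |κ| * ρ) := by
    have : κ * ρ ≤ |κ| * ρ := by gcongr; exact le_abs_self κ
    linarith
  have hf := hp.isBDFlow
  have hft := hpt.isBDFlow
  have hm0 : Summable fun n : ℕ => (n : ℝ) ^ ρ * p (max 0 0) n := by simpa using hm
  have hmt0 : Summable fun n : ℕ => (n : ℝ) ^ ρ * pt (max 0 0) n := by simpa using hmt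
  have hW : ∀ σ, 1 ≤ σ → σ ≤ ρ → ∀ r, 0 ≤ r →
      wassersteinPow σ (pmfMeasure (p r)) (pmfMeasure (pt r))
        = (transportCost σ (p (max r 0)) (pt (max r 0))).toReal := by
    intro σ h1 h2 r hr
    rw [← hf.wassersteinPow_eq hft hν0 hν hB0 hηB h1
      (summable_rpow_mul_of_le (by linarith) h2 (hf.isProbMass 0).1 hm0)
      (summable_rpow_mul_of_le (by linarith) h2 (hft.isProbMass 0).1 hmt0) hr, max_eq_left hr]
  have key := hf.transportCost_le hft hη0 hν0 hν hB' hρ hκB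
    (fun x => ciInf_le (bddBelow_curvature hη0 hν0 hB) x)
    (abs_sub_le_bdLip hη0 hηB) (abs_sub_le_bdLip hν0 fun x => (hB x).2) hm0 hmt0 ht
  rw [hW ρ hρ le_rfl t ht, hW ρ hρ le_rfl 0 le_rfl, ← intervalIntegral.integral_const_mul]
  convert key using 2
  · congr 2
    ring
  · refine intervalIntegral.integral_congr fun r hr => ?_
    rw [Set.uIcc_of_le ht] at hr
    rw [hW 1 le_rfl hρ r hr.1, mul_left_comm]
    congr 3
    split_ifs with h
    · exact hW (ρ - 1) (by linarith) (by linarith) r hr.1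
    · rfl
end

section
/- Consider a birth and death process whose birth rate satisfies η(x) ≤ C(1+x) for all x∈ℕ and some C>0, whose death rate ν is arbitrary with ν(0)=0, and whose Wasserstein curvature κ is finite (κ>−∞). Let {P_t} and {P̃_t} be the time marginals of two such processes with the same generator and initial laws P₀, P̃₀ on ℕ having finite first moments. Then for all t≥0, W₁(P_t,P̃_t) ≤ W₁(P₀,P̃₀) e^{−κt}. -/
open MeasureTheory

open Set Filter Topology

/-- The mass that `q` gives to `{0, …, n - 1}`. -/
noncomputable def partialMass (q : ℕ → ℝ) (n : ℕ) : ℝ := ∑ k ∈ Finset.range n, q k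

/-- `truncMean q N = E[min(X, N)]` when `X` has law `q`. -/
noncomputable def truncMean (q : ℕ → ℝ) (N : ℕ) : ℝ :=
  ∑ n ∈ Finset.range N, (1 - partialMass q (n + 1))

theorem partialMass_succ (q : ℕ → ℝ) (n : ℕ) :
    partialMass q (n + 1) = partialMass q n + q n := Finset.sum_range_succ _ _

section pmf

variable {q : ℕ → ℝ}

theorem partialMass_mono (h0 : ∀ x, 0 ≤ q x) : Monotone (partialMass q) :=
  monotone_nat_of_le_succ fun n => by rw [partialMass_succ]; linarith [h0 n]

theorem partialMass_nonneg (h0 : ∀ x, 0 ≤ q x) (n : ℕ) : 0 ≤ partialMass q n :=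
  Finset.sum_nonneg fun _ _ => h0 _

theorem partialMass_le_one (h0 : ∀ x, 0 ≤ q x) (h1 : HasSum q 1) (n : ℕ) :
    partialMass q n ≤ 1 :=
  sum_le_hasSum _ (fun _ _ => h0 _) h1

theorem hasSum_tail (h1 : HasSum q 1) (n : ℕ) :
    HasSum (fun k => q (k + n)) (1 - partialMass q n) :=
  (hasSum_nat_add_iff' n).2 h1

theorem truncMean_eq (q : ℕ → ℝ) (N : ℕ) :
    truncMean q N = ∑ n ∈ Finset.range N, n * q n + N * (1 - partialMass q N) := by
  induction N with
  | zero => simp [truncMean]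
  | succ N ih =>
    have : truncMean q (N + 1) = truncMean q N + (1 - partialMass q (N + 1)) :=
      Finset.sum_range_succ _ _
    rw [this, ih, Finset.sum_range_succ, partialMass_succ]
    push_cast
    ring

theorem sum_mul_le_truncMean (h0 : ∀ x, 0 ≤ q x) (h1 : HasSum q 1) (N : ℕ) :
    ∑ n ∈ Finset.range N, n * q n ≤ truncMean q N := by
  rw [truncMean_eq]
  have : 0 ≤ (N : ℝ) * (1 - partialMass q N) :=
    mul_nonneg N.cast_nonneg (sub_nonneg.2 (partialMass_le_one h0 h1 N))
  linarith

theorem truncMean_nonneg (h0 : ∀ x, 0 ≤ q x) (h1 : HasSum q 1) (N : ℕ) : 0 ≤ truncMean q N :=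
  Finset.sum_nonneg fun _ _ => sub_nonneg.2 (partialMass_le_one h0 h1 _)

theorem truncMean_le_tsum (h0 : ∀ x, 0 ≤ q x) (h1 : HasSum q 1)
    (hm : Summable fun n : ℕ => (n : ℝ) * q n) (N : ℕ) :
    truncMean q N ≤ ∑' n : ℕ, n * q n := by
  rw [truncMean_eq, ← hm.sum_add_tsum_nat_add N]
  gcongr
  refine hasSum_le (fun k => ?_) ((hasSum_tail h1 N).mul_left (N : ℝ))
    ((summable_nat_add_iff N).2 hm).hasSum
  have := h0 (k + N)
  push_cast
  nlinarith [mul_nonneg (Nat.cast_nonneg (α := ℝ) k) this]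

theorem summable_mul_of_truncMean_le (h0 : ∀ x, 0 ≤ q x) (h1 : HasSum q 1) {M : ℝ}
    (hM : ∀ N, truncMean q N ≤ M) : Summable fun n : ℕ => (n : ℝ) * q n :=
  summable_of_sum_range_le (fun n => mul_nonneg n.cast_nonneg (h0 n))
    fun N => (sum_mul_le_truncMean h0 h1 N).trans (hM N)

end pmf

namespace IsBDMarginal

variable {η ν : ℕ → ℝ} {C κ : ℝ} {p : ℝ → ℕ → ℝ}

theorem nonneg (h : IsBDMarginal η ν p) {t : ℝ} (ht : 0 ≤ t) (x : ℕ) : 0 ≤ p t x :=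
  (h.1 t ht).1 x

theorem hasSum_one (h : IsBDMarginal η ν p) {t : ℝ} (ht : 0 ≤ t) : HasSum (p t) 1 :=
  (h.1 t ht).2

theorem continuousOn (h : IsBDMarginal η ν p) (x : ℕ) :
    ContinuousOn (fun s => p s x) (Ici 0) :=
  fun t ht => (h.2 x t ht).continuousWithinAt

theorem continuousOn_partialMass (h : IsBDMarginal η ν p) (n : ℕ) :
    ContinuousOn (fun s => partialMass (p s) n) (Ici 0) :=
  continuousOn_finsetSum _ fun x _ => h.continuousOn x

theorem continuousOn_truncMean (h : IsBDMarginal η ν p) (N : ℕ) :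
    ContinuousOn (fun s => truncMean (p s) N) (Ici 0) :=
  continuousOn_finsetSum _ fun _ _ => continuousOn_const.sub (h.continuousOn_partialMass _)

theorem hasDerivWithinAt_partialMass (hν : ν 0 = 0) (h : IsBDMarginal η ν p) (n : ℕ) {t : ℝ}
    (ht : 0 ≤ t) :
    HasDerivWithinAt (fun s => partialMass (p s) (n + 1))
      (ν (n + 1) * p t (n + 1) - η n * p t n) (Ici 0) t := by
  induction n with
  | zero =>
    simp only [partialMass_succ]
    have := h.2 0 t ht
    simp only [hν, if_true] at this
    refine (this.const_add 0).congr_deriv (by ring) |>.congr_of_eventuallyEq ?_ ?_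
    · exact Eventually.of_forall fun s => by simp [partialMass]
    · simp [partialMass]
  | succ n ih =>
    have := ih.add (h.2 (n + 1) t ht)
    simp only [Nat.add_eq_zero_iff, one_ne_zero, and_false, if_false, Nat.add_sub_cancel] at this
    refine (this.congr_deriv (by ring)).congr_of_eventuallyEq ?_ ?_
    · exact Eventually.of_forall fun s => partialMass_succ _ _
    · exact partialMass_succ _ _

theorem hasDerivWithinAt_truncMean (hν : ν 0 = 0) (h : IsBDMarginal η ν p) (N : ℕ) {t : ℝ}
    (ht : 0 ≤ t) :
    HasDerivWithinAt (fun s => truncMean (p s) N)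
      (∑ n ∈ Finset.range N, (η n * p t n - ν (n + 1) * p t (n + 1))) (Ici 0) t := by
  refine HasDerivWithinAt.fun_sum fun n _ => ?_
  exact ((h.hasDerivWithinAt_partialMass hν n ht).const_sub 1).congr_deriv (by ring)

theorem sum_birth_le (hηC : ∀ x : ℕ, η x ≤ C * (1 + x)) (hC : 0 < C)
    (h : IsBDMarginal η ν p) {t : ℝ} (ht : 0 ≤ t) (N : ℕ) :
    ∑ n ∈ Finset.range N, η n * p t n ≤ C * (1 + truncMean (p t) N) := by
  have h0 := fun x => h.nonneg ht x
  have h1 := h.hasSum_one ht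
  calc ∑ n ∈ Finset.range N, η n * p t n
      ≤ ∑ n ∈ Finset.range N, C * (p t n + n * p t n) := by
        refine Finset.sum_le_sum fun n _ => ?_
        nlinarith [mul_le_mul_of_nonneg_right (hηC n) (h0 n)]
    _ = C * (partialMass (p t) N + ∑ n ∈ Finset.range N, n * p t n) := by
        rw [← Finset.mul_sum, Finset.sum_add_distrib]; rfl
    _ ≤ _ := by
        gcongr
        · exact partialMass_le_one h0 h1 N
        · exact sum_mul_le_truncMean h0 h1 N

theorem truncMean_le (hν0 : ∀ x, 0 ≤ ν x) (hν : ν 0 = 0)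
    (hηC : ∀ x : ℕ, η x ≤ C * (1 + x)) (hC : 0 < C) (h : IsBDMarginal η ν p)
    {t : ℝ} (ht : 0 ≤ t) (N : ℕ) :
    1 + truncMean (p t) N ≤ Real.exp (C * t) * (1 + truncMean (p 0) N) := by
  have key := intervalIntegral.sub_le_integral_of_hasDeriv_right_of_le (a := 0) (b := t)
    (g := fun s => Real.exp (-C * s) * (1 + truncMean (p s) N))
    (g' := fun s => Real.exp (-C * s) * -C * (1 + truncMean (p s) N) + Real.exp (-C * s) *
      (∑ n ∈ Finset.range N, (η n * p s n - ν (n + 1) * p s (n + 1))))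
    (φ := fun _ => 0) ht ?_ ?_ ?_ ?_
  · simp only [mul_zero, Real.exp_zero, intervalIntegral.integral_zero, one_mul] at key
    have := mul_le_mul_of_nonneg_left (sub_nonpos.1 key) (Real.exp_nonneg (C * t))
    rwa [← mul_assoc, ← Real.exp_add, neg_mul, add_neg_cancel, Real.exp_zero, one_mul] at this
  · exact (by fun_prop : Continuous fun s => Real.exp (-C * s)).continuousOn.mul
      (continuousOn_const.add ((h.continuousOn_truncMean N).mono Icc_subset_Ici_self))
  · intro x hx
    have e : HasDerivWithinAt (fun s => Real.exp (-C * s)) (Real.exp (-C * x) * -C) (Ioi x) x := by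
      simpa using ((hasDerivAt_id x).const_mul (-C)).exp.hasDerivWithinAt
    exact e.mul (((h.hasDerivWithinAt_truncMean hν N hx.1.le).mono
      (Ioi_subset_Ici hx.1.le)).const_add 1)
  · simp
  · intro x hx
    have h2 := h.sum_birth_le hηC hC hx.1.le N
    have h3 : 0 ≤ ∑ n ∈ Finset.range N, ν (n + 1) * p x (n + 1) :=
      Finset.sum_nonneg fun n _ => mul_nonneg (hν0 _) (h.nonneg hx.1.le _)
    rw [Finset.sum_sub_distrib]
    nlinarith [Real.exp_pos (-C * x)]

theorem intervalIntegrable (h : IsBDMarginal η ν p) (x : ℕ) {t : ℝ} (ht : 0 ≤ t) :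
    IntervalIntegrable (fun s => p s x) volume 0 t :=
  ((h.continuousOn x).mono (by rw [uIcc_of_le ht]; exact Icc_subset_Ici_self)).intervalIntegrable

theorem intervalIntegrable_sum (h : IsBDMarginal η ν p) (S : Finset ℕ) (c : ℕ → ℝ) (g : ℕ → ℕ)
    {t : ℝ} (ht : 0 ≤ t) :
    IntervalIntegrable (fun s => ∑ n ∈ S, c n * p s (g n)) volume 0 t := by
  simpa only [Finset.sum_fn] using IntervalIntegrable.sum S
    fun n _ => (h.intervalIntegrable (g n) ht).const_mul (c n)

theorem intervalIntegrable_partialMass (h : IsBDMarginal η ν p) (n : ℕ) {t : ℝ} (ht : 0 ≤ t) :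
    IntervalIntegrable (fun s => partialMass (p s) n) volume 0 t := by
  simpa [partialMass] using h.intervalIntegrable_sum (Finset.range n) 1 id ht

theorem occupation_nonneg (h : IsBDMarginal η ν p) (x : ℕ) {t : ℝ} (ht : 0 ≤ t) :
    0 ≤ ∫ s in (0 : ℝ)..t, p s x :=
  intervalIntegral.integral_nonneg ht fun _ hs => h.nonneg hs.1 x

theorem exists_truncMean_bound (hν0 : ∀ x, 0 ≤ ν x) (hν : ν 0 = 0)
    (hηC : ∀ x : ℕ, η x ≤ C * (1 + x)) (hC : 0 < C) (h : IsBDMarginal η ν p)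
    (hm : Summable fun n : ℕ => (n : ℝ) * p 0 n) (t : ℝ) :
    ∃ M, ∀ s ∈ Icc 0 t, ∀ N, truncMean (p s) N ≤ M := by
  refine ⟨Real.exp (C * t) * (1 + ∑' n : ℕ, n * p 0 n), fun s hs N => ?_⟩
  have h1 := h.truncMean_le hν0 hν hηC hC hs.1 N
  have h2 := truncMean_le_tsum (h.nonneg le_rfl) (h.hasSum_one le_rfl) hm N
  have h3 := truncMean_nonneg (h.nonneg le_rfl) (h.hasSum_one le_rfl) N
  have : Real.exp (C * s) * (1 + truncMean (p 0) N)
      ≤ Real.exp (C * t) * (1 + ∑' n : ℕ, n * p 0 n) := by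
    gcongr
    exact hs.2
  linarith

theorem summable_mul (hν0 : ∀ x, 0 ≤ ν x) (hν : ν 0 = 0)
    (hηC : ∀ x : ℕ, η x ≤ C * (1 + x)) (hC : 0 < C) (h : IsBDMarginal η ν p)
    (hm : Summable fun n : ℕ => (n : ℝ) * p 0 n) {t : ℝ} (ht : 0 ≤ t) :
    Summable fun n : ℕ => (n : ℝ) * p t n := by
  obtain ⟨M, hM⟩ := h.exists_truncMean_bound hν0 hν hηC hC hm t
  exact summable_mul_of_truncMean_le (h.nonneg ht) (h.hasSum_one ht) (hM t ⟨ht, le_rfl⟩)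

theorem summable_mul_occupation (hν0 : ∀ x, 0 ≤ ν x) (hν : ν 0 = 0)
    (hηC : ∀ x : ℕ, η x ≤ C * (1 + x)) (hC : 0 < C) (h : IsBDMarginal η ν p)
    (hm : Summable fun n : ℕ => (n : ℝ) * p 0 n) {t : ℝ} (ht : 0 ≤ t) :
    Summable fun n : ℕ => (n : ℝ) * ∫ s in (0 : ℝ)..t, p s n := by
  obtain ⟨M, hM⟩ := h.exists_truncMean_bound hν0 hν hηC hC hm t
  refine summable_of_sum_range_le (c := t * M)
    (fun n => mul_nonneg n.cast_nonneg (h.occupation_nonneg n ht)) fun N => ?_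
  simp only [← intervalIntegral.integral_const_mul]
  rw [← intervalIntegral.integral_finsetSum fun n _ => (h.intervalIntegrable n ht).const_mul _]
  have : ∫ _ in (0 : ℝ)..t, M = t * M := by simp
  rw [← this]
  refine intervalIntegral.integral_mono_on ht ?_ (by simp) fun s hs =>
    (sum_mul_le_truncMean (h.nonneg hs.1) (h.hasSum_one hs.1) N).trans (hM s hs N)
  exact h.intervalIntegrable_sum _ _ _ ht

theorem summable_death_occupation (hν0 : ∀ x, 0 ≤ ν x) (hν : ν 0 = 0)
    (hηC : ∀ x : ℕ, η x ≤ C * (1 + x)) (hC : 0 < C) (h : IsBDMarginal η ν p)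
    (hm : Summable fun n : ℕ => (n : ℝ) * p 0 n) {t : ℝ} (ht : 0 ≤ t) :
    Summable fun n : ℕ => ν n * ∫ s in (0 : ℝ)..t, p s n := by
  obtain ⟨M, hM⟩ := h.exists_truncMean_bound hν0 hν hηC hC hm t
  rw [← summable_nat_add_iff 1]
  refine summable_of_sum_range_le (c := M + t * (C * (1 + M)))
    (fun n => mul_nonneg (hν0 _) (h.occupation_nonneg _ ht)) fun N => ?_
  have hint : IntervalIntegrable
      (fun s => ∑ n ∈ Finset.range N, ν (n + 1) * p s (n + 1)) volume 0 t :=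
    h.intervalIntegrable_sum _ _ _ ht
  have key := intervalIntegral.sub_le_integral_of_hasDeriv_right_of_le (a := 0) (b := t)
    (g := fun s => truncMean (p s) N)
    (g' := fun s => ∑ n ∈ Finset.range N, (η n * p s n - ν (n + 1) * p s (n + 1)))
    (φ := fun s => C * (1 + M) - ∑ n ∈ Finset.range N, ν (n + 1) * p s (n + 1)) ht
    ((h.continuousOn_truncMean N).mono Icc_subset_Ici_self)
    (fun x hx => (h.hasDerivWithinAt_truncMean hν N hx.1.le).mono (Ioi_subset_Ici hx.1.le))
    ?_ ?_
  · rw [intervalIntegral.integral_sub (by simp) hint,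
      intervalIntegral.integral_finsetSum
        fun n _ => (h.intervalIntegrable _ ht).const_mul _] at key
    simp only [intervalIntegral.integral_const_mul, intervalIntegral.integral_const, sub_zero,
      smul_eq_mul] at key
    have h2 := hM 0 ⟨le_rfl, ht⟩ N
    have h3 := truncMean_nonneg (h.nonneg ht) (h.hasSum_one ht) N
    linarith
  · rw [← intervalIntegrable_iff_integrableOn_Icc_of_le ht]
    exact IntervalIntegrable.sub (by simp) hint
  · intro x hx
    have h2 := h.sum_birth_le hηC hC hx.1.le N
    have h3 := mul_le_mul_of_nonneg_left (hM x ⟨hx.1.le, hx.2.le⟩ N) hC.le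
    rw [Finset.sum_sub_distrib]
    linarith

theorem summable_occupation (h : IsBDMarginal η ν p) {t : ℝ} (ht : 0 ≤ t) :
    Summable fun n : ℕ => ∫ s in (0 : ℝ)..t, p s n := by
  refine summable_of_sum_range_le (c := t) (fun n => h.occupation_nonneg n ht) fun N => ?_
  rw [← intervalIntegral.integral_finsetSum fun n _ => h.intervalIntegrable n ht]
  have : ∫ _ in (0 : ℝ)..t, (1 : ℝ) = t := by simp
  nth_rw 2 [← this]
  refine intervalIntegral.integral_mono_on ht ?_ (by simp) fun s hs =>
    partialMass_le_one (h.nonneg hs.1) (h.hasSum_one hs.1) N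
  exact h.intervalIntegrable_partialMass N ht

theorem hasSum_occupation (h : IsBDMarginal η ν p) {t : ℝ} (ht : 0 ≤ t) :
    HasSum (fun n : ℕ => ∫ s in (0 : ℝ)..t, p s n) t := by
  have := hasSum_integral_of_summable_integral_norm (μ := volume.restrict (Ioc 0 t))
    (F := fun (n : ℕ) s => p s n) (fun n => (h.intervalIntegrable n ht).1) ?_
  · have e : ∫ s in Ioc 0 t, ∑' n, p s n = t := by
      rw [setIntegral_congr_fun (g := fun _ => (1 : ℝ)) measurableSet_Ioc
        fun s hs => (h.hasSum_one hs.1.le).tsum_eq]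
      simp [ht]
    rw [e] at this
    simpa only [intervalIntegral.integral_of_le ht] using this
  · refine (h.summable_occupation ht).congr fun n => ?_
    rw [intervalIntegral.integral_of_le ht]
    exact setIntegral_congr_fun measurableSet_Ioc fun s hs =>
      (Real.norm_of_nonneg (h.nonneg hs.1.le n)).symm

theorem integral_tail_eq (h : IsBDMarginal η ν p) (n : ℕ) {t : ℝ} (ht : 0 ≤ t) :
    ∫ s in (0 : ℝ)..t, (1 - partialMass (p s) n)
      = t - ∑ k ∈ Finset.range n, ∫ s in (0 : ℝ)..t, p s k := by
  rw [intervalIntegral.integral_sub (by simp) (h.intervalIntegrable_partialMass n ht)]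
  unfold partialMass
  rw [intervalIntegral.integral_finsetSum fun n _ => h.intervalIntegrable n ht]
  simp

theorem tendsto_death_mul_integral_tail (hη0 : ∀ x, 0 ≤ η x) (hν0 : ∀ x, 0 ≤ ν x)
    (hν : ν 0 = 0) (hηC : ∀ x : ℕ, η x ≤ C * (1 + x)) (hC : 0 < C)
    (hκ : ∀ x, κ ≤ η x + ν (x + 1) - η (x + 1) - ν x) (h : IsBDMarginal η ν p)
    (hm : Summable fun n : ℕ => (n : ℝ) * p 0 n) {t : ℝ} (ht : 0 ≤ t) :
    Tendsto (fun N => ν N * ∫ s in (0 : ℝ)..t, (1 - partialMass (p s) (N + 1))) atTop (𝓝 0) := by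
  set a : ℕ → ℝ := fun n => ∫ s in (0 : ℝ)..t, p s n
  have ha0 : ∀ n, 0 ≤ a n := fun n => h.occupation_nonneg n ht
  have hmono : ∀ N k, N ≤ k → ν N ≤ ν k + C * (1 + k) + |κ| * k := by
    have hm : Monotone fun x : ℕ => ν x - η x - κ * x :=
      monotone_nat_of_le_succ fun n => by push_cast; linarith [hκ n]
    intro N k hNk
    have h1 := hm hNk
    have hNk' : (N : ℝ) ≤ k := by exact_mod_cast hNk
    simp only at h1
    nlinarith [hη0 k, hηC N, neg_abs_le κ, mul_nonneg hC.le (sub_nonneg.2 hNk'),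
      mul_nonneg (abs_nonneg κ) (Nat.cast_nonneg (α := ℝ) N),
      mul_nonneg (by linarith [neg_abs_le κ] : 0 ≤ κ + |κ|) (sub_nonneg.2 hNk')]
  have hb : Summable fun k : ℕ => (ν k + C * (1 + k) + |κ| * k) * a k := by
    have h1 := h.summable_death_occupation hν0 hν hηC hC hm ht
    have h2 := h.summable_mul_occupation hν0 hν hηC hC hm ht
    have h3 := h.summable_occupation ht
    refine ((h1.add (h3.mul_left C)).add (h2.mul_left (C + |κ|))).congr fun k => ?_
    ring
  refine squeeze_zero (fun N => mul_nonneg (hν0 N) (intervalIntegral.integral_nonneg ht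
    fun s hs => sub_nonneg.2 (partialMass_le_one (h.nonneg hs.1) (h.hasSum_one hs.1) _)))
    (fun N => ?_) ((tendsto_sum_nat_add
      fun k : ℕ => (ν k + C * (1 + k) + |κ| * k) * a k).comp (tendsto_add_atTop_nat 1))
  rw [h.integral_tail_eq _ ht]
  refine hasSum_le (fun k => ?_)
    (((hasSum_nat_add_iff' (N + 1)).2 (h.hasSum_occupation ht)).mul_left (ν N))
    ((summable_nat_add_iff (N + 1)).2 hb).hasSum
  exact mul_le_mul_of_nonneg_right (hmono N _ (by omega)) (ha0 _)

end IsBDMarginal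

/-- If the right derivative of `f` is `a - c * f t`, then that of `|f|` is at most
`|a| - c * |f t|`. -/
theorem exists_hasDerivWithinAt_abs {f : ℝ → ℝ} {t a c A : ℝ} (ha : |a| ≤ A)
    (hf : HasDerivWithinAt f (a - c * f t) (Ioi t) t) :
    ∃ d, HasDerivWithinAt (fun s => |f s|) d (Ioi t) t ∧ d ≤ A - c * |f t| := by
  rcases lt_trichotomy (f t) 0 with h | h | h
  · refine ⟨-(a - c * f t), hf.neg.congr_of_eventuallyEq ?_ (abs_of_neg h), ?_⟩
    · filter_upwards [hf.continuousWithinAt.eventually_lt_const h] with s hs using abs_of_neg hs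
    · rw [abs_of_neg h]
      linarith [neg_abs_le a]
  · refine ⟨|a|, ?_, by simp [h, ha]⟩
    rw [h, mul_zero, sub_zero] at hf
    rw [hasDerivWithinAt_iff_tendsto_slope' self_notMem_Ioi] at hf ⊢
    refine hf.abs.congr' ?_
    filter_upwards [self_mem_nhdsWithin] with s hs
    have : 0 < s - t := sub_pos.2 hs
    simp [slope_def_field, h, abs_div, abs_of_pos this]
  · refine ⟨a - c * f t, hf.congr_of_eventuallyEq ?_ (abs_of_pos h), ?_⟩
    · filter_upwards [hf.continuousWithinAt.eventually_const_lt h] with s hs using abs_of_pos hs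
    · rw [abs_of_pos h]
      linarith [le_abs_self a]

theorem sum_flux_le {η ν : ℕ → ℝ} {κ : ℝ} (hν : ν 0 = 0)
    (hκ : ∀ x, κ ≤ η x + ν (x + 1) - η (x + 1) - ν x) {e : ℕ → ℝ} (he : ∀ n, 0 ≤ e n)
    (he0 : e 0 = 0) (N : ℕ) :
    ∑ n ∈ Finset.range N, (η n * e n + ν (n + 1) * e (n + 2) - (η n + ν (n + 1)) * e (n + 1))
      ≤ -κ * ∑ n ∈ Finset.range N, e (n + 1) + ν N * e (N + 1) - η N * e N := by
  induction N with
  | zero => simp [hν, he0]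
  | succ N ih =>
    rw [Finset.sum_range_succ, Finset.sum_range_succ]
    nlinarith [mul_le_mul_of_nonneg_right (hκ N) (he (N + 1))]

/-- The truncation to `{0, …, N - 1}` of the `L¹` distance between distribution functions. -/
noncomputable def cdfDist (q r : ℕ → ℝ) (N : ℕ) : ℝ :=
  ∑ n ∈ Finset.range N, |partialMass q (n + 1) - partialMass r (n + 1)|

theorem cdfDist_mono (q r : ℕ → ℝ) : Monotone (cdfDist q r) :=
  fun _ _ h => Finset.sum_le_sum_of_subset_of_nonneg (Finset.range_mono h)
    fun _ _ _ => abs_nonneg _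

namespace IsBDMarginal

variable {η ν : ℕ → ℝ} {C κ : ℝ} {p pt : ℝ → ℕ → ℝ}

theorem exists_hasDerivWithinAt_cdfDist (hη0 : ∀ x, 0 ≤ η x) (hν0 : ∀ x, 0 ≤ ν x)
    (hν : ν 0 = 0) (hκ : ∀ x, κ ≤ η x + ν (x + 1) - η (x + 1) - ν x)
    (h : IsBDMarginal η ν p) (h' : IsBDMarginal η ν pt) (N : ℕ) {t : ℝ} (ht : 0 ≤ t) :
    ∃ d, HasDerivWithinAt (fun s => cdfDist (p s) (pt s) N) d (Ioi t) t ∧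
      d ≤ -κ * cdfDist (p t) (pt t) N
        + ν N * |partialMass (p t) (N + 1) - partialMass (pt t) (N + 1)| := by
  have key : ∀ n, ∃ d, HasDerivWithinAt
      (fun s => |partialMass (p s) (n + 1) - partialMass (pt s) (n + 1)|) d (Ioi t) t ∧
      d ≤ η n * |partialMass (p t) n - partialMass (pt t) n|
        + ν (n + 1) * |partialMass (p t) (n + 2) - partialMass (pt t) (n + 2)|
        - (η n + ν (n + 1)) * |partialMass (p t) (n + 1) - partialMass (pt t) (n + 1)| := by
    intro n
    refine exists_hasDerivWithinAt_abs
      (a := η n * (partialMass (p t) n - partialMass (pt t) n)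
        + ν (n + 1) * (partialMass (p t) (n + 2) - partialMass (pt t) (n + 2)))
      (f := fun s => partialMass (p s) (n + 1) - partialMass (pt s) (n + 1)) ?_ ?_
    · refine (abs_add_le _ _).trans_eq ?_
      rw [abs_mul, abs_mul, abs_of_nonneg (hη0 _), abs_of_nonneg (hν0 _)]
    · refine (((h.hasDerivWithinAt_partialMass hν n ht).sub
        (h'.hasDerivWithinAt_partialMass hν n ht)).mono (Ioi_subset_Ici ht)).congr_deriv ?_
      simp only [partialMass_succ]
      ring
  choose d hd hd' using key
  refine ⟨_, HasDerivWithinAt.fun_sum fun n _ => hd n, ?_⟩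
  refine (Finset.sum_le_sum fun n _ => hd' n).trans ?_
  have := sum_flux_le hν hκ (e := fun n => |partialMass (p t) n - partialMass (pt t) n|)
    (fun _ => abs_nonneg _) (by simp [partialMass]) N
  refine this.trans ?_
  have := mul_nonneg (hη0 N) (abs_nonneg (partialMass (p t) N - partialMass (pt t) N))
  simp only [cdfDist]
  linarith

theorem exp_mul_cdfDist_le (hη0 : ∀ x, 0 ≤ η x) (hν0 : ∀ x, 0 ≤ ν x)
    (hν : ν 0 = 0) (hκ : ∀ x, κ ≤ η x + ν (x + 1) - η (x + 1) - ν x)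
    (h : IsBDMarginal η ν p) (h' : IsBDMarginal η ν pt) (N : ℕ) {t : ℝ} (ht : 0 ≤ t) :
    Real.exp (κ * t) * cdfDist (p t) (pt t) N ≤ cdfDist (p 0) (pt 0) N + Real.exp (|κ| * t) *
      (ν N * (∫ s in (0 : ℝ)..t, (1 - partialMass (p s) (N + 1)))
        + ν N * ∫ s in (0 : ℝ)..t, (1 - partialMass (pt s) (N + 1))) := by
  have hd := fun s : ℝ => fun hs : 0 ≤ s =>
    exists_hasDerivWithinAt_cdfDist hη0 hν0 hν hκ h h' N hs
  choose! d hd hd' using hd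
  have hint : ∀ {p : ℝ → ℕ → ℝ}, IsBDMarginal η ν p →
      IntervalIntegrable (fun s => 1 - partialMass (p s) (N + 1)) volume 0 t := fun h =>
    IntervalIntegrable.sub (by simp) (h.intervalIntegrable_partialMass (N + 1) ht)
  have key := intervalIntegral.sub_le_integral_of_hasDeriv_right_of_le (a := 0) (b := t)
    (g := fun s => Real.exp (κ * s) * cdfDist (p s) (pt s) N)
    (g' := fun s => Real.exp (κ * s) * κ * cdfDist (p s) (pt s) N + Real.exp (κ * s) * d s)
    (φ := fun s => Real.exp (|κ| * t) * (ν N * (1 - partialMass (p s) (N + 1))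
      + ν N * (1 - partialMass (pt s) (N + 1)))) ht ?_ ?_ ?_ ?_
  · rw [intervalIntegral.integral_const_mul, intervalIntegral.integral_add
      ((hint h).const_mul _) ((hint h').const_mul _), intervalIntegral.integral_const_mul,
      intervalIntegral.integral_const_mul] at key
    simp only [mul_zero, Real.exp_zero, one_mul] at key
    linarith
  · refine (by fun_prop : Continuous fun s => Real.exp (κ * s)).continuousOn.mul
      (ContinuousOn.mono ?_ Icc_subset_Ici_self)
    exact continuousOn_finsetSum _ fun n _ =>
      ((h.continuousOn_partialMass _).sub (h'.continuousOn_partialMass _)).abs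
  · intro x hx
    have e : HasDerivWithinAt (fun s => Real.exp (κ * s)) (Real.exp (κ * x) * κ) (Ioi x) x := by
      simpa using ((hasDerivAt_id x).const_mul κ).exp.hasDerivWithinAt
    exact e.mul (hd x hx.1.le)
  · rw [← intervalIntegrable_iff_integrableOn_Icc_of_le ht]
    exact (((hint h).const_mul _).add ((hint h').const_mul _)).const_mul _
  · intro x hx
    have h1 := hd' x hx.1.le
    have h2 : 0 ≤ 1 - partialMass (p x) (N + 1) :=
      sub_nonneg.2 (partialMass_le_one (h.nonneg hx.1.le) (h.hasSum_one hx.1.le) _)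
    have h3 : 0 ≤ 1 - partialMass (pt x) (N + 1) :=
      sub_nonneg.2 (partialMass_le_one (h'.nonneg hx.1.le) (h'.hasSum_one hx.1.le) _)
    have h4 : |partialMass (p x) (N + 1) - partialMass (pt x) (N + 1)|
        ≤ (1 - partialMass (p x) (N + 1)) + (1 - partialMass (pt x) (N + 1)) :=
      abs_le.2 ⟨by linarith, by linarith⟩
    have h5 : Real.exp (κ * x) ≤ Real.exp (|κ| * t) := by
      refine Real.exp_le_exp.2 ?_
      exact (mul_le_mul_of_nonneg_right (le_abs_self κ) hx.1.le).trans
        (mul_le_mul_of_nonneg_left hx.2.le (abs_nonneg κ))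
    calc Real.exp (κ * x) * κ * cdfDist (p x) (pt x) N + Real.exp (κ * x) * d x
        = Real.exp (κ * x) * (κ * cdfDist (p x) (pt x) N + d x) := by ring
      _ ≤ Real.exp (κ * x) * (ν N * ((1 - partialMass (p x) (N + 1))
          + (1 - partialMass (pt x) (N + 1)))) := by
        gcongr
        linarith [mul_le_mul_of_nonneg_left h4 (hν0 N)]
      _ ≤ Real.exp (|κ| * t) * (ν N * ((1 - partialMass (p x) (N + 1))
          + (1 - partialMass (pt x) (N + 1)))) :=
        mul_le_mul_of_nonneg_right h5 (mul_nonneg (hν0 N) (by linarith))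
      _ = _ := by ring

/-- Contraction of the `L¹` distance between distribution functions. -/
theorem cdfDist_le (hη0 : ∀ x, 0 ≤ η x) (hν0 : ∀ x, 0 ≤ ν x) (hν : ν 0 = 0)
    (hηC : ∀ x : ℕ, η x ≤ C * (1 + x)) (hC : 0 < C)
    (hκ : ∀ x, κ ≤ η x + ν (x + 1) - η (x + 1) - ν x)
    (h : IsBDMarginal η ν p) (h' : IsBDMarginal η ν pt)
    (hm : Summable fun n : ℕ => (n : ℝ) * p 0 n) (hm' : Summable fun n : ℕ => (n : ℝ) * pt 0 n)
    {W : ℝ} (hW : ∀ N, cdfDist (p 0) (pt 0) N ≤ W) (K : ℕ) {t : ℝ} (ht : 0 ≤ t) :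
    cdfDist (p t) (pt t) K ≤ W * Real.exp (-κ * t) := by
  have hlim := (((h.tendsto_death_mul_integral_tail hη0 hν0 hν hηC hC hκ hm ht).add
    (h'.tendsto_death_mul_integral_tail hη0 hν0 hν hηC hC hκ hm' ht)).const_mul
      (Real.exp (|κ| * t))).const_add W
  rw [add_zero, mul_zero, add_zero] at hlim
  have hle : Real.exp (κ * t) * cdfDist (p t) (pt t) K ≤ W := by
    refine ge_of_tendsto hlim ?_
    filter_upwards [eventually_ge_atTop K] with N hN
    refine (mul_le_mul_of_nonneg_left (cdfDist_mono _ _ hN) (Real.exp_nonneg _)).trans ?_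
    exact (exp_mul_cdfDist_le hη0 hν0 hν hκ h h' N ht).trans (by gcongr; exact hW N)
  rwa [neg_mul, Real.exp_neg, ← div_eq_mul_inv, le_div_iff₀ (Real.exp_pos _), mul_comm]

end IsBDMarginal

/-- The distance from `x` to `(-∞, n]`, truncated at `1`. -/
noncomputable def ramp (n : ℕ) (x : ℝ) : ℝ := max 0 (min 1 (x - n))

theorem ramp_mono (n : ℕ) : Monotone (ramp n) := fun _ _ h => by
  unfold ramp
  gcongr

theorem continuous_ramp (n : ℕ) : Continuous (ramp n) := by
  unfold ramp
  fun_prop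

theorem abs_ramp_le_one (n : ℕ) (x : ℝ) : |ramp n x| ≤ 1 := by
  unfold ramp
  rw [abs_of_nonneg (le_max_left _ _)]
  simp

theorem ramp_natCast (n k : ℕ) : ramp n k = if n + 1 ≤ k then 1 else 0 := by
  unfold ramp
  split_ifs with h
  · have : (n : ℝ) + 1 ≤ k := by exact_mod_cast h
    rw [min_eq_left (by linarith)]
    simp
  · have : (k : ℝ) ≤ n := by exact_mod_cast (by omega : k ≤ n)
    exact max_eq_left ((min_le_right _ _).trans (by linarith))

theorem sum_ramp (N : ℕ) (x : ℝ) : ∑ n ∈ Finset.range N, ramp n x = max 0 (min (N : ℝ) x) := by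
  induction N with
  | zero => simp
  | succ N ih =>
    have : (0 : ℝ) ≤ N := N.cast_nonneg
    rw [Finset.sum_range_succ, ih]
    unfold ramp
    push_cast
    simp only [max_def, min_def]
    split_ifs <;> linarith

theorem sum_abs_ramp_sub_le (N : ℕ) (x y : ℝ) :
    ∑ n ∈ Finset.range N, |ramp n x - ramp n y| ≤ |x - y| := by
  wlog h : y ≤ x generalizing x y
  · simpa only [abs_sub_comm] using this y x (le_of_not_ge h)
  rw [Finset.sum_congr rfl fun n _ => abs_of_nonneg (sub_nonneg.2 (ramp_mono n h)),
    Finset.sum_sub_distrib, sum_ramp, sum_ramp, abs_of_nonneg (sub_nonneg.2 h)]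
  have : (0 : ℝ) ≤ N := N.cast_nonneg
  simp only [max_def, min_def]
  split_ifs <;> linarith

theorem lintegral_pmfMeasure (q : ℕ → ℝ) (f : ℝ → ENNReal) :
    ∫⁻ x, f x ∂pmfMeasure q = ∑' n : ℕ, ENNReal.ofReal (q n) * f n := by
  simp [pmfMeasure, lintegral_sum_measure]

section coupling

variable {q r : ℕ → ℝ}

theorem isProbabilityMeasure_pmfMeasure (h0 : ∀ x, 0 ≤ q x) (h1 : HasSum q 1) :
    IsProbabilityMeasure (pmfMeasure q) := by
  constructor
  rw [← lintegral_one, lintegral_pmfMeasure]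
  simp [← ENNReal.ofReal_tsum_of_nonneg h0 h1.summable, h1.tsum_eq]

theorem integrable_id_pmfMeasure (h0 : ∀ x, 0 ≤ q x)
    (hm : Summable fun n : ℕ => (n : ℝ) * q n) : Integrable (fun x : ℝ => x) (pmfMeasure q) := by
  refine ⟨by fun_prop, ?_⟩
  rw [hasFiniteIntegral_iff_norm, lintegral_pmfMeasure]
  have : ∀ n : ℕ, ENNReal.ofReal (q n) * ENNReal.ofReal ‖(n : ℝ)‖ = ENNReal.ofReal (n * q n) :=
    fun n => by rw [← ENNReal.ofReal_mul (h0 n), Real.norm_natCast, mul_comm]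
  simp only [this]
  rw [← ENNReal.ofReal_tsum_of_nonneg (fun n => mul_nonneg n.cast_nonneg (h0 n)) hm]
  exact ENNReal.ofReal_lt_top

theorem integral_ramp_pmfMeasure (h0 : ∀ x, 0 ≤ q x) (h1 : HasSum q 1) (n : ℕ) :
    Integrable (ramp n) (pmfMeasure q) ∧
      ∫ x, ramp n x ∂pmfMeasure q = 1 - partialMass q (n + 1) := by
  have := isProbabilityMeasure_pmfMeasure h0 h1
  have hi : Integrable (ramp n) (pmfMeasure q) :=
    Integrable.of_bound (continuous_ramp n).aestronglyMeasurable 1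
      (Eventually.of_forall (abs_ramp_le_one n))
  refine ⟨hi, (hasSum_integral_measure hi).unique ?_⟩
  simp only [integral_smul_measure, integral_dirac, ENNReal.toReal_ofReal (h0 _), ramp_natCast,
    smul_eq_mul, mul_ite, mul_one, mul_zero]
  rw [← hasSum_nat_add_iff' (n + 1), Finset.sum_eq_zero, sub_zero]
  · exact (hasSum_tail h1 (n + 1)).congr_fun fun k => by simp
  · intro k hk
    rw [if_neg (by simpa using hk)]

theorem cdfDist_le_integral (h0 : ∀ x, 0 ≤ q x) (h1 : HasSum q 1) (h0' : ∀ x, 0 ≤ r x)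
    (h1' : HasSum r 1) (hm : Summable fun n : ℕ => (n : ℝ) * q n)
    (hm' : Summable fun n : ℕ => (n : ℝ) * r n) {π : Measure (ℝ × ℝ)}
    (hπ : IsCoupling π (pmfMeasure q) (pmfMeasure r)) (N : ℕ) :
    cdfDist q r N ≤ ∫ p, ‖p.1 - p.2‖ ^ (1 : ℝ) ∂π := by
  simp only [Real.rpow_one]
  have hfst : ∀ {f : ℝ → ℝ}, Integrable f (pmfMeasure q) → Integrable (fun p => f p.1) π :=
    fun hf => (hπ.1 ▸ hf : Integrable _ (π.map Prod.fst)).comp_measurable measurable_fst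
  have hsnd : ∀ {f : ℝ → ℝ}, Integrable f (pmfMeasure r) → Integrable (fun p => f p.2) π :=
    fun hf => (hπ.2 ▸ hf : Integrable _ (π.map Prod.snd)).comp_measurable measurable_snd
  have hi : ∀ n, Integrable (fun p : ℝ × ℝ => ramp n p.1 - ramp n p.2) π := fun n =>
    (hfst (integral_ramp_pmfMeasure h0 h1 n).1).sub (hsnd (integral_ramp_pmfMeasure h0' h1' n).1)
  calc cdfDist q r N
      ≤ ∑ n ∈ Finset.range N, ∫ p, |ramp n p.1 - ramp n p.2| ∂π := by
        refine Finset.sum_le_sum fun n _ => ?_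
        have e : ∫ p, (ramp n p.1 - ramp n p.2) ∂π
            = partialMass r (n + 1) - partialMass q (n + 1) := by
          rw [integral_sub (hfst (integral_ramp_pmfMeasure h0 h1 n).1)
            (hsnd (integral_ramp_pmfMeasure h0' h1' n).1),
            ← integral_map (φ := Prod.fst) (f := ramp n) (by fun_prop)
              (continuous_ramp n).aestronglyMeasurable,
            ← integral_map (φ := Prod.snd) (f := ramp n) (by fun_prop)
              (continuous_ramp n).aestronglyMeasurable, hπ.1, hπ.2,
            (integral_ramp_pmfMeasure h0 h1 n).2, (integral_ramp_pmfMeasure h0' h1' n).2]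
          ring
        rw [abs_sub_comm, ← e]
        exact abs_integral_le_integral_abs
    _ = ∫ p, ∑ n ∈ Finset.range N, |ramp n p.1 - ramp n p.2| ∂π :=
        (integral_finsetSum _ fun n _ => (hi n).abs).symm
    _ ≤ _ := integral_mono (integrable_finsetSum _ fun n _ => (hi n).abs)
        ((hfst (integrable_id_pmfMeasure h0 hm)).sub
          (hsnd (integrable_id_pmfMeasure h0' hm'))).norm
        fun p => sum_abs_ramp_sub_le N p.1 p.2

open Classical in
/-- The quantile function of the law `q` (with junk value `0` on `[1, ∞)`). -/
noncomputable def quantile (q : ℕ → ℝ) (u : ℝ) : ℕ :=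
  if h : ∃ n, u < partialMass q (n + 1) ∨ 1 ≤ u then Nat.find h else 0

theorem exists_lt_partialMass (h1 : HasSum q 1) (u : ℝ) :
    ∃ n, u < partialMass q (n + 1) ∨ 1 ≤ u := by
  by_contra! H
  have : Tendsto (fun n => partialMass q (n + 1)) atTop (𝓝 1) :=
    h1.tendsto_sum_nat.comp (tendsto_add_atTop_nat 1)
  exact absurd (H 0).2 (not_lt.2 (le_of_tendsto' this fun n => (H n).1))

theorem measurable_quantile (h1 : HasSum q 1) : Measurable (quantile q) := by
  classical
  have : quantile q = fun u => Nat.find (exists_lt_partialMass h1 u) := by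
    ext u
    rw [quantile, dif_pos (exists_lt_partialMass h1 u)]
  rw [this]
  exact measurable_find _ fun k => (measurableSet_Iio (a := partialMass q (k + 1))).union
    (measurableSet_Ici (a := (1 : ℝ)))

theorem quantile_le_iff (h0 : ∀ x, 0 ≤ q x) (h1 : HasSum q 1) {u : ℝ} (hu : u < 1) (n : ℕ) :
    quantile q u ≤ n ↔ u < partialMass q (n + 1) := by
  classical
  rw [quantile, dif_pos (exists_lt_partialMass h1 u), Nat.find_le_iff]
  constructor
  · rintro ⟨m, hm, h | h⟩
    · exact h.trans_le (partialMass_mono h0 (by omega))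
    · exact absurd hu (not_lt.2 h)
  · exact fun h => ⟨n, le_rfl, Or.inl h⟩

theorem map_quantile (h0 : ∀ x, 0 ≤ q x) (h1 : HasSum q 1) :
    (volume.restrict (Ico (0 : ℝ) 1)).map (fun u => (quantile q u : ℝ)) = pmfMeasure q := by
  have hmeas := measurable_quantile h1
  have hs : ∀ n : ℕ, (volume.restrict (Ico (0 : ℝ) 1)).map (quantile q) {n}
      = ENNReal.ofReal (q n) := by
    intro n
    rw [Measure.map_apply hmeas (measurableSet_singleton n),
      Measure.restrict_apply (hmeas (measurableSet_singleton n))]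
    have : quantile q ⁻¹' {n} ∩ Ico 0 1 = Ico (partialMass q n) (partialMass q (n + 1)) := by
      ext u
      have hle := partialMass_le_one h0 h1 (n + 1)
      have hge := partialMass_nonneg h0 n
      simp only [mem_inter_iff, mem_preimage, mem_singleton_iff, mem_Ico]
      by_cases hu : u < 1
      · have a := quantile_le_iff h0 h1 hu n
        cases n with
        | zero =>
          simp only [nonpos_iff_eq_zero] at a
          simp [a, hu, partialMass, and_comm]
        | succ n =>
          have b := quantile_le_iff h0 h1 hu n
          constructor
          · rintro ⟨h, h2, -⟩
            exact ⟨not_lt.1 fun h' => absurd (b.2 h') (by omega), a.1 h.le⟩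
          · rintro ⟨h, h2⟩
            have := a.2 h2
            have := mt b.1 (not_lt.2 h)
            exact ⟨by omega, hge.trans h, hu⟩
      · constructor
        · exact fun h => absurd h.2.2 hu
        · exact fun h => absurd (h.2.trans_le hle) hu
    rw [this, Real.volume_Ico, partialMass_succ]
    congr 1
    ring
  rw [show (fun u => (quantile q u : ℝ)) = Nat.cast ∘ quantile q from rfl,
    ← Measure.map_map (by fun_prop) hmeas, ← Measure.sum_smul_dirac (Measure.map (quantile q) _),
    Measure.map_sum (by fun_prop)]
  simp [pmfMeasure, hs, Measure.map_smul, Measure.map_dirac]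

theorem ofReal_abs_natCast_sub (a b : ℕ) :
    ENNReal.ofReal |(a : ℝ) - b|
      = ∑' n : ℕ, if (a ≤ n ∧ ¬ b ≤ n) ∨ (b ≤ n ∧ ¬ a ≤ n) then 1 else 0 := by
  wlog h : a ≤ b generalizing a b
  · rw [abs_sub_comm, this b a (by omega)]
    simp only [or_comm]
  rw [tsum_eq_sum (s := Finset.Ico a b)]
  · rw [Finset.sum_congr rfl (g := fun _ => 1), abs_sub_comm, ← Nat.cast_sub h]
    · simp
    · intro n hn
      rw [Finset.mem_Ico] at hn
      rw [if_pos (by omega)]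
  · intro n hn
    rw [Finset.mem_Ico] at hn
    rw [if_neg (by omega)]

theorem exists_coupling (h0 : ∀ x, 0 ≤ q x) (h1 : HasSum q 1) (h0' : ∀ x, 0 ≤ r x)
    (h1' : HasSum r 1) :
    ∃ π : Measure (ℝ × ℝ), IsCoupling π (pmfMeasure q) (pmfMeasure r) ∧
      ∀ W, 0 ≤ W → (∀ N, cdfDist q r N ≤ W) → ∫ p, ‖p.1 - p.2‖ ^ (1 : ℝ) ∂π ≤ W := by
  have hq : Measurable fun u => (quantile q u : ℝ) := by
    have := measurable_quantile h1
    fun_prop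
  have hr : Measurable fun u => (quantile r u : ℝ) := by
    have := measurable_quantile h1'
    fun_prop
  refine ⟨(volume.restrict (Ico (0 : ℝ) 1)).map fun u => (↑(quantile q u), ↑(quantile r u)),
    ⟨?_, ?_⟩, fun W hW0 hW => ?_⟩
  · rw [Measure.map_map measurable_fst (hq.prodMk hr)]
    exact map_quantile h0 h1
  · rw [Measure.map_map measurable_snd (hq.prodMk hr)]
    exact map_quantile h0' h1'
  · simp only [Real.rpow_one]
    rw [integral_map (hq.prodMk hr).aemeasurable (by fun_prop),
      integral_eq_lintegral_of_nonneg_ae (Eventually.of_forall fun _ => norm_nonneg _)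
        (by fun_prop)]
    refine ENNReal.toReal_le_of_le_ofReal hW0 ?_
    have hset : ∀ n u, u ∈ Ico (0 : ℝ) 1 →
        (if (quantile q u ≤ n ∧ ¬ quantile r u ≤ n) ∨ (quantile r u ≤ n ∧ ¬ quantile q u ≤ n)
          then (1 : ENNReal) else 0)
        = (Ico (min (partialMass q (n + 1)) (partialMass r (n + 1)))
            (max (partialMass q (n + 1)) (partialMass r (n + 1)))).indicator 1 u := by
      intro n u hu
      rw [indicator_apply]
      refine if_congr ?_ rfl rfl
      simp only [quantile_le_iff h0 h1 hu.2, quantile_le_iff h0' h1' hu.2, mem_Ico,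
        min_le_iff, lt_max_iff, not_lt]
      constructor
      · tauto
      · rintro ⟨h | h, h' | h'⟩
        · exact absurd h' (not_lt.2 h)
        · exact Or.inr ⟨h', h⟩
        · exact Or.inl ⟨h', h⟩
        · exact absurd h' (not_lt.2 h)
    calc ∫⁻ u in Ico (0 : ℝ) 1, ENNReal.ofReal ‖(quantile q u : ℝ) - quantile r u‖
        = ∫⁻ u in Ico (0 : ℝ) 1, ∑' n : ℕ,
            (Ico (min (partialMass q (n + 1)) (partialMass r (n + 1)))
            (max (partialMass q (n + 1)) (partialMass r (n + 1)))).indicator 1 u := by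
          refine setLIntegral_congr_fun measurableSet_Ico fun u hu => ?_
          simp only [Real.norm_eq_abs, ofReal_abs_natCast_sub]
          exact tsum_congr fun n => hset n u hu
      _ ≤ ∫⁻ u, ∑' n : ℕ,
            (Ico (min (partialMass q (n + 1)) (partialMass r (n + 1)))
            (max (partialMass q (n + 1)) (partialMass r (n + 1)))).indicator 1 u :=
          setLIntegral_le_lintegral _ _
      _ = ∑' n : ℕ, ENNReal.ofReal |partialMass q (n + 1) - partialMass r (n + 1)| := by
          rw [lintegral_tsum fun n => (measurable_one.indicator measurableSet_Ico).aemeasurable]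
          refine tsum_congr fun n => ?_
          rw [lintegral_indicator_one measurableSet_Ico, Real.volume_Ico, max_sub_min_eq_abs']
      _ ≤ ENNReal.ofReal W := by
          refine ENNReal.tsum_le_of_sum_range_le fun N => ?_
          rw [← ENNReal.ofReal_sum_of_nonneg fun _ _ => abs_nonneg _]
          exact ENNReal.ofReal_le_ofReal (hW N)

theorem wassersteinPow_le (h0 : ∀ x, 0 ≤ q x) (h1 : HasSum q 1) (h0' : ∀ x, 0 ≤ r x)
    (h1' : HasSum r 1) {W : ℝ} (hW : ∀ N, cdfDist q r N ≤ W) :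
    wassersteinPow 1 (pmfMeasure q) (pmfMeasure r) ≤ W := by
  obtain ⟨π, hπ, hle⟩ := exists_coupling h0 h1 h0' h1'
  refine le_trans (csInf_le ⟨0, ?_⟩ ?_) (hle W (hW 0) hW)
  · rintro _ ⟨π, -, rfl⟩
    exact integral_nonneg fun _ => by positivity
  · exact ⟨π, hπ, rfl⟩

theorem cdfDist_le_wassersteinPow (h0 : ∀ x, 0 ≤ q x) (h1 : HasSum q 1) (h0' : ∀ x, 0 ≤ r x)
    (h1' : HasSum r 1) (hm : Summable fun n : ℕ => (n : ℝ) * q n)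
    (hm' : Summable fun n : ℕ => (n : ℝ) * r n) (N : ℕ) :
    cdfDist q r N ≤ wassersteinPow 1 (pmfMeasure q) (pmfMeasure r) := by
  obtain ⟨π, hπ, -⟩ := exists_coupling h0 h1 h0' h1'
  refine le_csInf ⟨_, π, hπ, rfl⟩ ?_
  rintro _ ⟨π, hπ, rfl⟩
  exact cdfDist_le_integral h0 h1 h0' h1' hm hm' hπ N

end coupling

/-- for a birth and death process with affine-growth birth rate and finite
Wasserstein curvature `κ`, `W₁(P_t, P̃_t) ≤ W₁(P₀, P̃₀) e^{−κt}`. -/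
theorem stmt9 (η ν : ℕ → ℝ) (hη0 : ∀ x, 0 ≤ η x) (hν0 : ∀ x, 0 ≤ ν x) (hν : ν 0 = 0)
    (C : ℝ) (hC : 0 < C) (hηgrowth : ∀ x : ℕ, η x ≤ C * (1 + x))
    (hκ : BddBelow (Set.range fun x : ℕ => η x + ν (x + 1) - η (x + 1) - ν x))
    (p pt : ℝ → ℕ → ℝ) (hp : IsBDMarginal η ν p) (hpt : IsBDMarginal η ν pt)
    (hm : Summable fun n : ℕ => (n : ℝ) * p 0 n)
    (hmt : Summable fun n : ℕ => (n : ℝ) * pt 0 n) :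
    ∀ t : ℝ, 0 ≤ t →
      wassersteinPow 1 (pmfMeasure (p t)) (pmfMeasure (pt t))
        ≤ wassersteinPow 1 (pmfMeasure (p 0)) (pmfMeasure (pt 0))
            * Real.exp (-(bdKappa η ν) * t) := by
  intro t ht
  exact wassersteinPow_le (hp.nonneg ht) (hp.hasSum_one ht) (hpt.nonneg ht) (hpt.hasSum_one ht)
    fun K => hp.cdfDist_le hη0 hν0 hν hηgrowth hC (fun x => ciInf_le hκ x) hpt hm hmt
      (cdfDist_le_wassersteinPow (hp.nonneg le_rfl) (hp.hasSum_one le_rfl) (hpt.nonneg le_rfl)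
        (hpt.hasSum_one le_rfl) hm hmt) K ht
end
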